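/- arXiv:2201.12974 — 2 statements merged into one kernel-verified Lean document; each statement's English description precedes it below -/
import Mathlib

section
/- Let ψ : ℕ → ℝ⁺ with ψ(n)/(log n) → α for some α ≥ 1. Then E_sup(Λ,ψ) = {x ∈ Λ : limsup_{n→∞} (log a_n(x))/ψ(n) = 1} has Hausdorff dimension (α-1)/(2α). -/
open Filter MeasureTheory Set

/-- The Gauss map. -/
noncomputable def gaussMap (x : ℝ) : ℝ := Int.fract x⁻¹

/-- The `n`-th partial quotient (for `n ≥ 1`) of the continued fraction expansion of `x`. -/
noncomputable def cfA (n : ℕ) (x : ℝ) : ℕ := ⌊(gaussMap^[n - 1] x)⁻¹⌋₊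

/-- The set `Λ` of points of `(0,1)` whose partial quotients are non-decreasing. -/
noncomputable def Lam : Set ℝ :=
  {x | x ∈ Set.Ioo (0:ℝ) 1 ∧ ∀ n : ℕ, 1 ≤ n → cfA n x ≤ cfA (n + 1) x}


/-- zero-based digits -/
noncomputable def dig (k : ℕ) (x : ℝ) : ℕ := ⌊(gaussMap^[k] x)⁻¹⌋₊

lemma cfA_succ (k : ℕ) (x : ℝ) : cfA (k + 1) x = dig k x := by
  simp [cfA, dig]

lemma dig_succ (k : ℕ) (x : ℝ) : dig (k + 1) x = dig k (gaussMap x) := by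
  simp [dig]

lemma gauss_mem (x : ℝ) : 0 ≤ gaussMap x ∧ gaussMap x < 1 :=
  ⟨Int.fract_nonneg _, Int.fract_lt_one _⟩

lemma eq_inv_dig {x : ℝ} (hx : 0 < x) : x = 1 / ((dig 0 x : ℝ) + gaussMap x) := by
  have h : ((dig 0 x : ℝ) + gaussMap x) = x⁻¹ := by
    simp only [dig, gaussMap, Function.iterate_zero, id]
    rw [natCast_floor_eq_intCast_floor (by positivity)]
    exact Int.floor_add_fract _
  rw [h]; simp

lemma dig_zero_pos {x : ℝ} (hx : x ∈ Ioo (0:ℝ) 1) : 1 ≤ dig 0 x := by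
  simp only [dig, Function.iterate_zero, id]
  rw [Nat.one_le_floor_iff]
  exact (one_le_inv₀ hx.1).2 hx.2.le

lemma pos_of_dig {x : ℝ} (h0 : 0 ≤ x) (h : 1 ≤ dig 0 x) : 0 < x := by
  rcases h0.lt_or_eq with h1 | h1
  · exact h1
  · subst h1; simp [dig] at h

lemma mem_Lam_iff {x : ℝ} : x ∈ Lam ↔ x ∈ Ioo (0:ℝ) 1 ∧ Monotone (fun k => dig k x) := by
  constructor
  · rintro ⟨h1, h2⟩
    refine ⟨h1, monotone_nat_of_le_succ fun n => ?_⟩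
    have := h2 (n + 1) (by omega)
    simpa only [cfA_succ] using this
  · rintro ⟨h1, h2⟩
    refine ⟨h1, fun n hn => ?_⟩
    obtain ⟨k, rfl⟩ : ∃ k, n = k + 1 := ⟨n - 1, by omega⟩
    simpa only [cfA_succ] using h2 (Nat.le_succ k)

lemma gauss_Lam {x : ℝ} (hx : x ∈ Lam) : gaussMap x ∈ Lam := by
  rw [mem_Lam_iff] at hx ⊢
  obtain ⟨h1, h2⟩ := hx
  refine ⟨⟨?_, (gauss_mem x).2⟩, ?_⟩
  · apply pos_of_dig (gauss_mem x).1
    rw [← dig_succ]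
    exact (dig_zero_pos h1).trans (h2 (Nat.zero_le 1))
  · intro a b hab
    have := h2 (Nat.succ_le_succ hab)
    simpa only [dig_succ, Nat.succ_eq_add_one] using this

lemma f_dist {a u v : ℝ} (ha : 0 < a) (hu : 0 ≤ u) (hv : 0 ≤ v) :
    |1 / (a + u) - 1 / (a + v)| = |u - v| / ((a + u) * (a + v)) := by
  have h1 : 0 < a + u := by linarith
  have h2 : 0 < a + v := by linarith
  rw [div_sub_div _ _ h1.ne' h2.ne', abs_div, abs_of_pos (mul_pos h1 h2), ← abs_neg]
  congr 2; ring

lemma f_dist_le {a u v : ℝ} (ha : 0 < a) (hu : 0 ≤ u) (hv : 0 ≤ v) :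
    |1 / (a + u) - 1 / (a + v)| ≤ |u - v| / a ^ 2 := by
  rw [f_dist ha hu hv]
  gcongr
  nlinarith [mul_nonneg hu hv]

lemma dimH_pre (A : Set ℝ) (m : ℕ) : dimH {x | x ∈ Lam ∧ gaussMap^[m] x ∈ A} ≤ dimH A := by
  induction m with
  | zero => exact dimH_mono (fun x hx => hx.2)
  | succ m ih =>
    have hsub : {x | x ∈ Lam ∧ gaussMap^[m + 1] x ∈ A} ⊆
        ⋃ a : ℕ, (fun y : ℝ => 1 / (((a + 1 : ℕ) : ℝ) + y)) ''
          {x | x ∈ Lam ∧ gaussMap^[m] x ∈ A} := by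
      rintro x ⟨hx, hxA⟩
      have h1 := (mem_Lam_iff.1 hx).1
      have hd := dig_zero_pos h1
      refine mem_iUnion.2 ⟨dig 0 x - 1, gaussMap x, ⟨gauss_Lam hx, by simpa using hxA⟩, ?_⟩
      simp only [Nat.sub_add_cancel hd]
      exact (eq_inv_dig h1.1).symm
    refine (dimH_mono hsub).trans ?_
    rw [dimH_iUnion]
    refine iSup_le fun a => le_trans ?_ ih
    apply LipschitzOnWith.dimH_image_le (K := 1)
    apply LipschitzOnWith.of_dist_le_mul
    rintro u ⟨hu, -⟩ v ⟨hv, -⟩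
    have ha : (1:ℝ) ≤ ((a + 1 : ℕ) : ℝ) := by push_cast; linarith [Nat.cast_nonneg (α := ℝ) a]
    simp only [Real.dist_eq, NNReal.coe_one, one_mul]
    refine (f_dist_le (by linarith) hu.1.1.le hv.1.1.le).trans ?_
    apply div_le_self (abs_nonneg _)
    nlinarith

/-- finite truncation sets -/
def FF (n M N : ℕ) : Set ℝ := {x | x ∈ Lam ∧ M ≤ dig 0 x ∧ ∀ k < n, dig k x ≤ N}

lemma exp_aux {z : ℝ} (h0 : 0 ≤ z) (h1 : z ≤ 1 / 2) : 1 ≤ Real.exp (2 * z) * (1 - z) := by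
  have := Real.add_one_le_exp (2 * z)
  nlinarith

lemma cover (s : ℝ) (hs : 0 < s) (N : ℕ) : ∀ j M n : ℕ, N + 1 - M = j → 2 ≤ M →
    2 * (M : ℝ) ^ (-(2 * s)) ≤ 1 / 2 →
    ∃ L : List (Set ℝ × ℝ), (∀ p ∈ L, p.1 ⊆ Icc 0 1 ∧ 0 ≤ p.2 ∧ p.2 ≤ (1 / 4) ^ n ∧
        ∀ x ∈ p.1, ∀ y ∈ p.1, |x - y| ≤ p.2) ∧
      (∀ x ∈ FF n M N, ∃ p ∈ L, x ∈ p.1) ∧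
      (L.map (fun p => p.2 ^ s)).sum ≤
        (1 / 2) ^ n * Real.exp (4 * ∑ k ∈ Finset.Icc M N, (k : ℝ) ^ (-(2 * s))) := by
  intro j
  induction j with
  | zero =>
    intro M n hj hM hM2
    rcases n with _ | n
    · refine ⟨[(Icc 0 1, 1)], ?_, ?_, ?_⟩
      · simp only [List.mem_singleton, forall_eq]
        refine ⟨subset_rfl, by norm_num, by norm_num, ?_⟩
        intro x hx y hy
        rw [abs_le]; constructor <;> linarith [hx.1, hx.2, hy.1, hy.2]
      · intro x hx
        exact ⟨_, List.mem_singleton.2 rfl, hx.1.1.1.le, hx.1.1.2.le⟩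
      · simp only [List.map_cons, List.map_nil, List.sum_cons, List.sum_nil, Real.one_rpow,
          pow_zero, one_mul, add_zero]
        apply Real.one_le_exp
        positivity
    · refine ⟨[], by simp, ?_, by simp; positivity⟩
      rintro x ⟨-, h1, h2⟩
      have := h2 0 (by omega)
      omega
  | succ j ihj =>
    intro M n hj hM hM2
    have hMN : M ≤ N := by omega
    have hMpos : (0:ℝ) < M := by exact_mod_cast (by omega : 0 < M)
    induction n with
    | zero =>
      refine ⟨[(Icc 0 1, 1)], ?_, ?_, ?_⟩
      · simp only [List.mem_singleton, forall_eq]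
        refine ⟨subset_rfl, by norm_num, by norm_num, ?_⟩
        intro x hx y hy
        rw [abs_le]; constructor <;> linarith [hx.1, hx.2, hy.1, hy.2]
      · intro x hx
        exact ⟨_, List.mem_singleton.2 rfl, hx.1.1.1.le, hx.1.1.2.le⟩
      · simp only [List.map_cons, List.map_nil, List.sum_cons, List.sum_nil, Real.one_rpow,
          pow_zero, one_mul, add_zero]
        apply Real.one_le_exp
        positivity
    | succ n ihn =>
      have hM3 : 2 * ((M + 1 : ℕ) : ℝ) ^ (-(2 * s)) ≤ 1 / 2 := by
        refine le_trans ?_ hM2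
        gcongr 2 * ?_
        apply Real.rpow_le_rpow_of_nonpos hMpos
        · push_cast; linarith
        · linarith
      obtain ⟨L1, h11, h12, h13⟩ := ihj (M + 1) (n + 1) (by omega) (by omega) hM3
      obtain ⟨L2, h21, h22, h23⟩ := ihn
      refine ⟨L1 ++ L2.map (fun p => ((fun y : ℝ => 1 / ((M : ℝ) + y)) '' p.1,
        p.2 / (M : ℝ) ^ 2)), ?_, ?_, ?_⟩
      · intro p hp
        rcases List.mem_append.1 hp with hp | hp
        · exact h11 p hp
        · obtain ⟨q, hq, rfl⟩ := List.mem_map.1 hp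
          obtain ⟨hq1, hq2, hq3, hq4⟩ := h21 q hq
          have hM4 : (2:ℝ) ≤ M := by exact_mod_cast hM
          refine ⟨?_, by positivity, ?_, ?_⟩
          · rintro _ ⟨y, hy, rfl⟩
            have := hq1 hy
            have h3 : 0 < (M:ℝ) + y := by linarith [this.1]
            refine ⟨by positivity, ?_⟩
            rw [div_le_one h3]; linarith [this.1]
          · rw [pow_succ, div_eq_mul_inv]
            apply mul_le_mul hq3 _ (by positivity) (by positivity)
            rw [one_div]
            apply inv_anti₀ (by norm_num)
            nlinarith
          · rintro _ ⟨y, hy, rfl⟩ _ ⟨z, hz, rfl⟩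
            refine (f_dist_le hMpos (hq1 hy).1 (hq1 hz).1).trans ?_
            exact div_le_div_of_nonneg_right (hq4 y hy z hz) (by positivity)
      · rintro x ⟨hx1, hx2, hx3⟩
        by_cases hx : M + 1 ≤ dig 0 x
        · obtain ⟨p, hp, hxp⟩ := h12 x ⟨hx1, hx, hx3⟩
          exact ⟨p, List.mem_append_left _ hp, hxp⟩
        · have hxM : dig 0 x = M := by omega
          have hg := gauss_Lam hx1
          have hmem : gaussMap x ∈ FF n M N := by
            refine ⟨hg, ?_, fun k hk => ?_⟩
            · rw [← dig_succ]
              exact hx2.trans ((mem_Lam_iff.1 hx1).2 (Nat.zero_le 1))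
            · rw [← dig_succ]
              exact hx3 _ (by omega)
          obtain ⟨p, hp, hxp⟩ := h22 (gaussMap x) hmem
          · refine ⟨_, List.mem_append_right _ (List.mem_map.2 ⟨p, hp, rfl⟩), gaussMap x, hxp, ?_⟩
            rw [← hxM]
            exact (eq_inv_dig hx1.1.1).symm
      · have hL2 : ((L2.map (fun p => ((fun y : ℝ => 1 / ((M : ℝ) + y)) '' p.1,
            p.2 / (M : ℝ) ^ 2))).map (fun p => p.2 ^ s)).sum =
            (L2.map (fun p => p.2 ^ s)).sum * (M : ℝ) ^ (-(2 * s)) := by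
          rw [List.map_map, ← List.sum_map_mul_right]
          congr 1
          apply List.map_congr_left
          intro p hp
          have := (h21 p hp).2.1
          simp only [Function.comp]
          rw [Real.div_rpow this (by positivity), Real.rpow_neg hMpos.le, Real.rpow_mul hMpos.le,
            div_eq_mul_inv]
          norm_num
        rw [List.map_append, List.sum_append, hL2]
        have hS : ∑ k ∈ Finset.Icc M N, (k : ℝ) ^ (-(2 * s)) =
            (M : ℝ) ^ (-(2 * s)) + ∑ k ∈ Finset.Icc (M + 1) N, (k : ℝ) ^ (-(2 * s)) := by
          rw [← Finset.insert_Icc_add_one_left_eq_Icc hMN, Finset.sum_insert (by simp)]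
        rw [hS] at h23 ⊢
        set z := (M : ℝ) ^ (-(2 * s)) with hz
        have hz0 : 0 < z := by positivity
        set S := ∑ k ∈ Finset.Icc (M + 1) N, (k : ℝ) ^ (-(2 * s))
        have hE := exp_aux (z := 2 * z) (by positivity) hM2
        have hexp : Real.exp (4 * (z + S)) = Real.exp (2 * (2 * z)) * Real.exp (4 * S) := by
          rw [← Real.exp_add]; ring_nf
        rw [hexp] at h23 ⊢
        have h4 : (L2.map (fun p => p.2 ^ s)).sum * z ≤
            (1 / 2) ^ n * (Real.exp (2 * (2 * z)) * Real.exp (4 * S)) * z := by gcongr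
        refine (add_le_add h13 h4).trans ?_
        have h5 : 0 < (1 / 2 : ℝ) ^ n := by positivity
        have h6 := Real.exp_pos (4 * S)
        have h7 : 0 < (1 / 2 : ℝ) ^ n * Real.exp (4 * S) := by positivity
        rw [pow_succ]
        nlinarith [mul_le_mul_of_nonneg_left hE h7.le]

lemma sum_rpow_le (θ : ℝ) (h0 : 0 < θ) (h1 : θ < 1) (N : ℕ) :
    ∑ k ∈ Finset.Icc 1 N, (k : ℝ) ^ (θ - 1) ≤ (N : ℝ) ^ θ / θ := by
  induction N with
  | zero => simp [h0.ne']
  | succ N ih =>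
    rw [Finset.sum_Icc_succ_top (by omega)]
    have hk : (0:ℝ) < ((N + 1 : ℕ) : ℝ) := by positivity
    have hb := rpow_one_add_le_one_add_mul_self (s := -(1 / ((N + 1 : ℕ) : ℝ))) (p := θ)
      (by rw [neg_le_neg_iff, div_le_one hk]; push_cast; linarith [Nat.cast_nonneg (α := ℝ) N])
      h0.le h1.le
    have he : 1 + -(1 / ((N + 1 : ℕ) : ℝ)) = N / ((N + 1 : ℕ) : ℝ) := by
      field_simp; push_cast; ring
    rw [he, Real.div_rpow (by positivity) hk.le, div_le_iff₀ (by positivity)] at hb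
    rw [Real.rpow_sub_one hk.ne']
    have : (N:ℝ) ^ θ / θ + ((N + 1 : ℕ) : ℝ) ^ θ / ((N + 1 : ℕ) : ℝ) ≤ ((N + 1 : ℕ) : ℝ) ^ θ / θ := by
      rw [div_add' _ _ _ h0.ne']
      gcongr
      refine (add_le_add_left hb _).trans (le_of_eq ?_)
      field_simp
      ring
    linarith

/-- The core sets for the upper bound. -/
def FI (M C : ℕ) (β : ℝ) : Set ℝ :=
  {x | x ∈ Lam ∧ M ≤ dig 0 x ∧ ∀ k, (dig k x : ℝ) ≤ C * ((k + 1 : ℕ) : ℝ) ^ β}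

lemma exp_bound (K τ : ℝ) (h1 : τ < 1) :
    ∃ B : ℝ, ∀ n : ℕ, (1 / 2 : ℝ) ^ n * Real.exp (K * (n : ℝ) ^ τ) ≤ B := by
  have hlim : Tendsto (fun n : ℕ => (n : ℝ) ^ (τ - 1)) atTop (nhds 0) := by
    have := (tendsto_rpow_neg_atTop (y := 1 - τ) (by linarith)).comp tendsto_natCast_atTop_atTop
    simpa [Function.comp_def] using this
  have hlim2 : Tendsto (fun n : ℕ => K * (n : ℝ) ^ (τ - 1)) atTop (nhds 0) := by
    simpa using hlim.const_mul K
  have hev : ∀ᶠ n : ℕ in atTop, (1 / 2 : ℝ) ^ n * Real.exp (K * (n : ℝ) ^ τ) ≤ 1 := by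
    filter_upwards [hlim2.eventually (gt_mem_nhds (Real.log_pos one_lt_two)),
      eventually_gt_atTop 0] with n hn hn0
    have hn1 : (0:ℝ) < n := by exact_mod_cast hn0
    rw [Real.rpow_sub_one hn1.ne', mul_div_assoc', div_lt_iff₀ hn1] at hn
    have : (1 / 2 : ℝ) ^ n = Real.exp (-(Real.log 2 * n)) := by
      rw [Real.exp_neg, mul_comm, Real.exp_nat_mul, Real.exp_log (by norm_num)]; simp
    rw [this, ← Real.exp_add]
    apply Real.exp_le_one_iff.2
    linarith
  obtain ⟨B, hB⟩ := (Filter.IsBoundedUnder.bddAbove_range ⟨1, by simpa using hev⟩ :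
    BddAbove (range fun n : ℕ => (1 / 2 : ℝ) ^ n * Real.exp (K * (n : ℝ) ^ τ)))
  exact ⟨B, fun n => hB ⟨n, rfl⟩⟩

lemma dimH_FI (s : NNReal) (hs : 0 < s) (hs2 : (s : ℝ) < 1 / 2) (β : ℝ) (hβ : 1 ≤ β)
    (h : β * (1 - 2 * s) < 1) (M C : ℕ) (hM : 2 ≤ M)
    (hM2 : 2 * (M : ℝ) ^ (-(2 * (s : ℝ))) ≤ 1 / 2) : dimH (FI M C β) ≤ s := by
  have hs' : (0:ℝ) < s := hs
  set θ : ℝ := 1 - 2 * s with hθ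
  have hθ0 : 0 < θ := by linarith
  apply dimH_le_of_hausdorffMeasure_ne_top
  let Nn : ℕ → ℕ := fun n => ⌊C * (n : ℝ) ^ β⌋₊
  choose L hL1 hL2 hL3 using fun n => cover s hs' (Nn n) _ M n rfl hM hM2
  obtain ⟨B, hB⟩ := exp_bound (4 * ((C : ℝ) ^ θ / θ)) (β * θ) h
  have hbound : ∀ n, ((L n).map (fun p => p.2 ^ (s : ℝ))).sum ≤ B := by
    intro n
    refine (hL3 n).trans (le_trans ?_ (hB n))
    gcongr (1 / 2) ^ n * Real.exp ?_
    rw [mul_assoc]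
    gcongr 4 * ?_
    have h1 : ∑ k ∈ Finset.Icc M (Nn n), (k : ℝ) ^ (-(2 * (s : ℝ))) ≤
        ∑ k ∈ Finset.Icc 1 (Nn n), (k : ℝ) ^ (θ - 1) := by
      have : θ - 1 = -(2 * (s:ℝ)) := by rw [hθ]; ring
      rw [this]
      apply Finset.sum_le_sum_of_subset_of_nonneg
      · exact Finset.Icc_subset_Icc_left (by omega)
      · intros; positivity
    refine h1.trans ((sum_rpow_le θ hθ0 (by linarith) _).trans ?_)
    rw [div_mul_eq_mul_div]
    gcongr
    have : (Nn n : ℝ) ≤ C * (n : ℝ) ^ β := Nat.floor_le (by positivity)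
    calc (Nn n : ℝ) ^ θ ≤ (C * (n : ℝ) ^ β) ^ θ := by gcongr
      _ = _ := by rw [Real.mul_rpow (by positivity) (by positivity), ← Real.rpow_mul (by positivity)]
  have hdiam : ∀ n, ∀ i : Fin (L n).length, Metric.ediam ((L n)[i]).1 ≤ ENNReal.ofReal ((L n)[i]).2 := by
    intro n i
    apply Metric.ediam_le
    intro x hx y hy
    rw [edist_dist, Real.dist_eq]
    exact ENNReal.ofReal_le_ofReal ((hL1 n _ (List.getElem_mem _)).2.2.2 x hx y hy)
  have key := Measure.hausdorffMeasure_le_liminf_sum (ι := fun n => Fin (L n).length) (s : ℝ)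
    (FI M C β) (l := atTop) (fun n : ℕ => ENNReal.ofReal ((1 / 4 : ℝ) ^ n)) ?_
    (fun n i => ((L n)[i]).1) ?_ ?_
  · refine ne_top_of_le_ne_top (b := ENNReal.ofReal B) ENNReal.ofReal_ne_top (key.trans ?_)
    refine (liminf_le_liminf (v := fun _ : ℕ => ENNReal.ofReal B)
      (Eventually.of_forall fun n => ?_)).trans (by simp)
    calc ∑ i : Fin (L n).length, Metric.ediam ((L n)[i]).1 ^ (s : ℝ)
        ≤ ∑ i : Fin (L n).length, ENNReal.ofReal (((L n)[i]).2 ^ (s : ℝ)) := by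
          apply Finset.sum_le_sum
          intro i _
          have hi : 0 ≤ ((L n)[i]).2 := (hL1 n _ (List.getElem_mem i.2)).2.1
          rw [← ENNReal.ofReal_rpow_of_nonneg hi hs'.le]
          exact ENNReal.rpow_le_rpow (hdiam n i) hs'.le
      _ = ENNReal.ofReal (∑ i : Fin (L n).length, (((L n)[i]).2 ^ (s : ℝ))) := by
          rw [ENNReal.ofReal_sum_of_nonneg]
          intro i _
          exact Real.rpow_nonneg (hL1 n _ (List.getElem_mem _)).2.1 _
      _ ≤ ENNReal.ofReal B := by
          apply ENNReal.ofReal_le_ofReal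
          refine le_trans (le_of_eq ?_) (hbound n)
          exact Fin.sum_univ_fun_getElem (L n) (fun p => p.2 ^ (s : ℝ))
  · have := tendsto_pow_atTop_nhds_zero_of_lt_one (r := (1 / 4 : ℝ)) (by norm_num) (by norm_num)
    simpa using ENNReal.tendsto_ofReal this
  · refine Eventually.of_forall fun n i => (hdiam n i).trans ?_
    exact ENNReal.ofReal_le_ofReal (hL1 n _ (List.getElem_mem _)).2.2.1
  · refine Eventually.of_forall fun n x hx => ?_
    obtain ⟨h1, h2, h3⟩ := hx
    have hmem : x ∈ FF n M (Nn n) := by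
      refine ⟨h1, h2, fun k hk => ?_⟩
      apply Nat.le_floor
      refine (h3 k).trans ?_
      gcongr
      omega
    obtain ⟨p, hp, hxp⟩ := hL2 n x hmem
    obtain ⟨i, hi, rfl⟩ := List.mem_iff_getElem.1 hp
    exact mem_iUnion.2 ⟨⟨i, hi⟩, hxp⟩

lemma psi_tendsto (ψ : ℕ → ℝ) (α : ℝ) (hα1 : 1 ≤ α)
    (hα : Tendsto (fun n : ℕ => ψ n / Real.log n) atTop (nhds α)) : Tendsto ψ atTop atTop := by
  have hlog : Tendsto (fun n : ℕ => Real.log n) atTop atTop :=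
    Real.tendsto_log_atTop.comp tendsto_natCast_atTop_atTop
  have h := hα.pos_mul_atTop (by linarith) hlog
  refine h.congr' ?_
  filter_upwards [hlog.eventually_gt_atTop 0] with n hn
  field_simp

lemma digits_bound (ψ : ℕ → ℝ) (hψpos : ∀ n, 0 < ψ n) (α : ℝ) (hα1 : 1 ≤ α)
    (hα : Tendsto (fun n : ℕ => ψ n / Real.log n) atTop (nhds α)) {x : ℝ}
    (hx : Filter.limsup (fun n : ℕ => ((Real.log (cfA n x) / ψ n : ℝ) : EReal)) atTop =
          (1 : EReal)) (β : ℝ) (hβ : α < β) :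
    ∀ᶠ n : ℕ in atTop, (cfA n x : ℝ) ≤ (n : ℝ) ^ β := by
  have hlog : Tendsto (fun n : ℕ => Real.log n) atTop atTop :=
    Real.tendsto_log_atTop.comp tendsto_natCast_atTop_atTop
  have hα0 : 0 < α := by linarith
  obtain ⟨c, hc1, hc2⟩ := exists_between ((one_lt_div hα0).2 hβ)
  have hc0 : 0 < c := by linarith
  have hc3 : α < β / c := by
    rw [lt_div_iff₀ hα0] at hc2
    rw [lt_div_iff₀ hc0]; linarith
  have hev : ∀ᶠ n : ℕ in atTop, ((Real.log (cfA n x) / ψ n : ℝ) : EReal) < (c : EReal) := by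
    refine eventually_lt_of_limsup_lt ?_
    rw [hx]
    exact_mod_cast hc1
  filter_upwards [hev, hα.eventually (gt_mem_nhds hc3), hlog.eventually_gt_atTop 0,
    eventually_gt_atTop 0] with n h1 h2 h3 h4
  have hn : (0:ℝ) < n := by exact_mod_cast h4
  have h1' : Real.log (cfA n x) / ψ n < c := by exact_mod_cast h1
  rw [div_lt_iff₀ (hψpos n)] at h1'
  rw [div_lt_iff₀ h3] at h2
  have h5 : Real.log (cfA n x) < Real.log n * β := by
    calc _ < c * ψ n := h1'
      _ < c * (β / c * Real.log n) := by gcongr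
      _ = _ := by field_simp
  rcases Nat.eq_zero_or_pos (cfA n x) with h0 | h0
  · rw [h0]; simp; positivity
  · have h0' : (0:ℝ) < cfA n x := by exact_mod_cast h0
    rw [← Real.exp_log h0', Real.rpow_def_of_pos hn]
    exact Real.exp_le_exp.2 h5.le

lemma digits_unbdd (ψ : ℕ → ℝ) (hψpos : ∀ n, 0 < ψ n) (α : ℝ) (hα1 : 1 ≤ α)
    (hα : Tendsto (fun n : ℕ => ψ n / Real.log n) atTop (nhds α)) {x : ℝ}
    (hx : Filter.limsup (fun n : ℕ => ((Real.log (cfA n x) / ψ n : ℝ) : EReal)) atTop =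
          (1 : EReal)) (M : ℕ) (hM : 1 ≤ M) : ∃ m, M ≤ dig m x := by
  have hfr : ∃ᶠ n : ℕ in atTop, ((1 / 2 : ℝ) : EReal) < ((Real.log (cfA n x) / ψ n : ℝ) : EReal) := by
    apply frequently_lt_of_lt_limsup
    · isBoundedDefault
    rw [hx]
    exact_mod_cast (by norm_num : (1 / 2 : ℝ) < 1)
  have hev : ∀ᶠ n : ℕ in atTop, 2 * Real.log M ≤ ψ n ∧ 0 < n :=
    ((psi_tendsto ψ α hα1 hα).eventually_ge_atTop _).and (eventually_gt_atTop 0)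
  obtain ⟨n, h1, h2, h3⟩ := (hfr.and_eventually hev).exists
  have h1' : 1 / 2 < Real.log (cfA n x) / ψ n := by exact_mod_cast h1
  rw [lt_div_iff₀ (hψpos n)] at h1'
  refine ⟨n - 1, ?_⟩
  rw [← cfA_succ, Nat.sub_add_cancel h3]
  by_contra hlt
  push Not at hlt
  have : Real.log (cfA n x) ≤ Real.log M := by
    rcases Nat.eq_zero_or_pos (cfA n x) with h0 | h0
    · rw [h0]; simpa using Real.log_nonneg (by exact_mod_cast hM)
    · apply Real.log_le_log
      · exact_mod_cast h0
      · exact_mod_cast hlt.le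
  linarith

lemma dig_iter (m k : ℕ) (x : ℝ) : dig k (gaussMap^[m] x) = dig (k + m) x := by
  simp [dig, Function.iterate_add_apply]

lemma iter_Lam (m : ℕ) {x : ℝ} (hx : x ∈ Lam) : gaussMap^[m] x ∈ Lam := by
  induction m with
  | zero => exact hx
  | succ m ih => rw [Function.iterate_succ_apply']; exact gauss_Lam ih

lemma upper (ψ : ℕ → ℝ) (hψpos : ∀ n, 0 < ψ n) (α : ℝ) (hα1 : 1 ≤ α)
    (hα : Tendsto (fun n : ℕ => ψ n / Real.log n) atTop (nhds α)) :
    dimH {x | x ∈ Lam ∧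
        Filter.limsup (fun n : ℕ => ((Real.log (cfA n x) / ψ n : ℝ) : EReal)) atTop =
          (1 : EReal)} ≤
      ENNReal.ofReal ((α - 1) / (2 * α)) := by
  have hα0 : 0 < α := by linarith
  apply le_of_forall_gt_imp_ge_of_dense
  intro a ha
  have hhalf : ENNReal.ofReal ((α - 1) / (2 * α)) < ENNReal.ofReal (1 / 2) := by
    rw [ENNReal.ofReal_lt_ofReal_iff (by norm_num), div_lt_div_iff₀ (by positivity) (by norm_num)]
    linarith
  obtain ⟨s, hs1, hs2⟩ := ENNReal.lt_iff_exists_nnreal_btwn.1 (lt_min ha hhalf)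
  refine le_trans ?_ (hs2.le.trans (min_le_left _ _))
  have hs3 : (s : ℝ) < 1 / 2 := by
    have := hs2.trans_le (min_le_right _ _)
    rw [← ENNReal.ofReal_coe_nnreal, ENNReal.ofReal_lt_ofReal_iff (by norm_num)] at this
    exact this
  have hs0 : 0 < s := by
    have : (0 : ENNReal) < s := lt_of_le_of_lt (zero_le) hs1
    exact_mod_cast this
  have hs4 : (α - 1) / (2 * α) < s := by
    rw [← ENNReal.ofReal_coe_nnreal, ENNReal.ofReal_lt_ofReal_iff (by exact_mod_cast hs0)] at hs1
    exact hs1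
  have hθ : 0 < 1 - 2 * (s : ℝ) := by linarith
  have hαθ : α < 1 / (1 - 2 * (s : ℝ)) := by
    rw [lt_div_iff₀ hθ]
    rw [div_lt_iff₀ (by positivity)] at hs4
    linarith
  obtain ⟨β, hβ1, hβ2⟩ := exists_between hαθ
  rw [lt_div_iff₀ hθ] at hβ2
  have hs' : (0:ℝ) < s := hs0
  obtain ⟨M, hM2, hM⟩ : ∃ M : ℕ, 2 * (M : ℝ) ^ (-(2 * (s : ℝ))) ≤ 1 / 2 ∧ 2 ≤ M := by
    have h1 : Tendsto (fun n : ℕ => 2 * (n : ℝ) ^ (-(2 * (s : ℝ)))) atTop (nhds 0) := by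
      have := (tendsto_rpow_neg_atTop (y := 2 * (s:ℝ)) (by linarith)).comp
        tendsto_natCast_atTop_atTop
      simpa [Function.comp_def] using this.const_mul 2
    exact ((h1.eventually_le_const (by norm_num)).and (eventually_ge_atTop 2)).exists
  have hsub : {x | x ∈ Lam ∧
        Filter.limsup (fun n : ℕ => ((Real.log (cfA n x) / ψ n : ℝ) : EReal)) atTop =
          (1 : EReal)} ⊆ ⋃ m : ℕ, ⋃ C : ℕ, {x | x ∈ Lam ∧ gaussMap^[m] x ∈ FI M C β} := by
    rintro x ⟨hxL, hx⟩
    obtain ⟨m, hm⟩ := digits_unbdd ψ hψpos α hα1 hα hx M (by omega)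
    have hb := digits_bound ψ hψpos α hα1 hα hx β hβ1
    have hev : ∀ᶠ k : ℕ in atTop,
        (dig (k + m) x : ℝ) / ((k + 1 : ℕ) : ℝ) ^ β ≤ ((m + 1 : ℕ) : ℝ) ^ β := by
      filter_upwards [(tendsto_add_atTop_nat (m + 1)).eventually hb] with k hk
      rw [← add_assoc, cfA_succ] at hk
      rw [div_le_iff₀ (by positivity), ← Real.mul_rpow (by positivity) (by positivity)]
      refine hk.trans ?_
      apply Real.rpow_le_rpow (by positivity) _ (by linarith)
      push_cast
      nlinarith [Nat.cast_nonneg (α := ℝ) k, Nat.cast_nonneg (α := ℝ) m,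
        mul_nonneg (Nat.cast_nonneg (α := ℝ) k) (Nat.cast_nonneg (α := ℝ) m)]
    obtain ⟨B, hB⟩ := (Filter.IsBoundedUnder.bddAbove_range ⟨_, by simpa using hev⟩ :
      BddAbove (range fun k : ℕ => (dig (k + m) x : ℝ) / ((k + 1 : ℕ) : ℝ) ^ β))
    obtain ⟨C, hC⟩ := exists_nat_ge B
    refine mem_iUnion.2 ⟨m, mem_iUnion.2 ⟨C, hxL, iter_Lam m hxL, ?_, fun k => ?_⟩⟩
    · rw [dig_iter, zero_add]; exact hm
    · rw [dig_iter, ← div_le_iff₀ (by positivity)]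
      exact (hB ⟨k, rfl⟩).trans hC
  refine (dimH_mono hsub).trans ?_
  rw [dimH_iUnion]
  refine iSup_le fun m => ?_
  rw [dimH_iUnion]
  refine iSup_le fun C => (dimH_pre _ m).trans ?_
  exact dimH_FI s hs0 hs3 β (by linarith) hβ2 M C hM hM2

/-- Finite continued fractions. -/
noncomputable def WW : ℕ → (ℕ → ℕ) → ℝ
  | 0, _ => 0
  | n + 1, d => 1 / ((d 0 : ℝ) + WW n (fun k => d (k + 1)))

lemma WW_mem (n : ℕ) : ∀ d : ℕ → ℕ, (∀ k, 2 ≤ d k) → 0 ≤ WW n d ∧ WW n d ≤ 1 / 2 := by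
  induction n with
  | zero => intro d _; simp [WW]
  | succ n ih =>
    intro d hd
    have h := ih (fun k => d (k + 1)) (fun k => hd _)
    have h2 : (2:ℝ) ≤ d 0 := by exact_mod_cast hd 0
    simp only [WW]
    refine ⟨by have := h.1; positivity, ?_⟩
    apply one_div_le_one_div_of_le (by norm_num)
    linarith [h.1]

lemma WW_dist (n : ℕ) : ∀ d : ℕ → ℕ, (∀ k, 2 ≤ d k) → dist (WW n d) (WW (n + 1) d) ≤
    1 * (1 / 4) ^ n := by
  induction n with
  | zero =>
    intro d hd
    have h := WW_mem 1 d hd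
    have h0 : WW 0 d = 0 := rfl
    rw [h0, Real.dist_eq, zero_sub, abs_neg, abs_of_nonneg h.1]
    simp only [pow_zero]
    linarith [h.2]
  | succ n ih =>
    intro d hd
    have hd' : ∀ k, 2 ≤ (fun k => d (k + 1)) k := fun k => hd _
    have h2 : (2:ℝ) ≤ d 0 := by exact_mod_cast hd 0
    have h := ih _ hd'
    rw [Real.dist_eq] at h ⊢
    have := f_dist_le (a := d 0) (by linarith) (WW_mem n _ hd').1 (WW_mem (n + 1) _ hd').1
    rw [WW, WW]
    refine this.trans ?_
    rw [div_le_iff₀ (by positivity)]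
    refine h.trans ?_
    rw [pow_succ]
    have : (0:ℝ) < (1 / 4) ^ n := by positivity
    nlinarith [mul_le_mul_of_nonneg_left (by nlinarith : (4:ℝ) ≤ (d 0 : ℝ) ^ 2) this.le]

lemma exists_cf : ∃ X : (ℕ → ℕ) → ℝ, ∀ d : ℕ → ℕ, (∀ k, 2 ≤ d k) →
    0 ≤ X d ∧ X d ≤ 1 / 2 ∧ X d = 1 / ((d 0 : ℝ) + X (fun k => d (k + 1))) := by
  have hlim : ∀ d : ℕ → ℕ, ∃ x, (∀ k, 2 ≤ d k) → Tendsto (fun n => WW n d) atTop (nhds x) := by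
    intro d
    by_cases hd : ∀ k, 2 ≤ d k
    · obtain ⟨x, hx⟩ := cauchySeq_tendsto_of_complete
        (cauchySeq_of_le_geometric (1 / 4) 1 (by norm_num) (fun n => WW_dist n d hd))
      exact ⟨x, fun _ => hx⟩
    · exact ⟨0, fun h => absurd h hd⟩
  choose X hX using hlim
  refine ⟨X, fun d hd => ?_⟩
  have h0 : ∀ d : ℕ → ℕ, (∀ k, 2 ≤ d k) → 0 ≤ X d := fun d hd =>
    ge_of_tendsto' (hX d hd) (fun n => (WW_mem n d hd).1)
  refine ⟨h0 d hd, le_of_tendsto' (hX d hd) (fun n => (WW_mem n d hd).2), ?_⟩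
  have hd' : ∀ k, 2 ≤ (fun k => d (k + 1)) k := fun k => hd _
  have h2 : (2:ℝ) ≤ d 0 := by exact_mod_cast hd 0
  have h1 : Tendsto (fun n => WW (n + 1) d) atTop
      (nhds (1 / ((d 0 : ℝ) + X (fun k => d (k + 1))))) := by
    have := (hX _ hd').const_add (d 0 : ℝ)
    exact Tendsto.div tendsto_const_nhds this (by linarith [h0 _ hd'])
  exact tendsto_nhds_unique ((tendsto_add_atTop_iff_nat 1).2 (hX d hd)) h1

/-- The continued fraction with given digits. -/
noncomputable def XX : (ℕ → ℕ) → ℝ := Classical.choose exists_cf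

lemma XX_spec (d : ℕ → ℕ) (hd : ∀ k, 2 ≤ d k) :
    0 ≤ XX d ∧ XX d ≤ 1 / 2 ∧ XX d = 1 / ((d 0 : ℝ) + XX (fun k => d (k + 1))) :=
  Classical.choose_spec exists_cf d hd

lemma XX_inv (d : ℕ → ℕ) (hd : ∀ k, 2 ≤ d k) :
    (XX d)⁻¹ = (d 0 : ℝ) + XX (fun k => d (k + 1)) := by
  rw [(XX_spec d hd).2.2]; simp

lemma XX_gauss (d : ℕ → ℕ) (hd : ∀ k, 2 ≤ d k) : gaussMap (XX d) = XX (fun k => d (k + 1)) := by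
  have h := XX_spec (fun k => d (k + 1)) (fun k => hd _)
  rw [gaussMap, XX_inv d hd, Int.fract_natCast_add, Int.fract_eq_self]
  exact ⟨h.1, by linarith [h.2.1]⟩

lemma XX_dig (k : ℕ) : ∀ d : ℕ → ℕ, (∀ k, 2 ≤ d k) → dig k (XX d) = d k := by
  induction k with
  | zero =>
    intro d hd
    have h := XX_spec (fun k => d (k + 1)) (fun k => hd _)
    simp only [dig, Function.iterate_zero, id]
    rw [XX_inv d hd, add_comm, Nat.floor_add_natCast h.1, Nat.floor_eq_zero.2 (by linarith [h.2.1]), zero_add]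
  | succ k ih =>
    intro d hd
    rw [dig_succ, XX_gauss d hd, ih _ (fun k => hd _)]

lemma XX_mem (d : ℕ → ℕ) (hd : ∀ k, 2 ≤ d k) : XX d ∈ Ioo (0:ℝ) 1 := by
  have h := XX_spec d hd
  refine ⟨?_, by linarith [h.2.1]⟩
  apply pos_of_dig h.1
  rw [XX_dig 0 d hd]
  linarith [hd 0]

lemma XX_sep (n : ℕ) : ∀ (d e : ℕ → ℕ) (U : ℕ → ℝ), (∀ k, 2 ≤ d k) → (∀ k, 2 ≤ e k) →
    (∀ k, (d k : ℝ) + 1 ≤ U k) → (∀ k, (e k : ℝ) + 1 ≤ U k) → (∀ k < n, d k = e k) →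
    d n ≠ e n → 1 / 2 * ∏ k ∈ Finset.range (n + 1), (U k ^ 2)⁻¹ ≤ |XX d - XX e| := by
  induction n with
  | zero =>
    intro d e U hd he hdU heU _ hne
    obtain ⟨-, -, hd3⟩ := XX_spec d hd
    obtain ⟨-, -, he3⟩ := XX_spec e he
    obtain ⟨hd1, hd2, -⟩ := XX_spec (fun k => d (k + 1)) (fun k => hd _)
    obtain ⟨he1, he2, -⟩ := XX_spec (fun k => e (k + 1)) (fun k => he _)
    rw [hd3, he3]
    set u := XX (fun k => d (k + 1))
    set v := XX (fun k => e (k + 1))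
    have h2 : (2:ℝ) ≤ d 0 := by exact_mod_cast hd 0
    have h3 : (2:ℝ) ≤ e 0 := by exact_mod_cast he 0
    have h4 : 0 < (d 0 : ℝ) + u := by linarith
    have h5 : 0 < (e 0 : ℝ) + v := by linarith
    rw [div_sub_div _ _ h4.ne' h5.ne', abs_div, abs_of_pos (mul_pos h4 h5), div_eq_mul_inv]
    simp only [zero_add, Finset.prod_range_one]
    apply mul_le_mul
    · rcases lt_or_gt_of_ne hne with h | h
      · have : (d 0 : ℝ) + 1 ≤ e 0 := by exact_mod_cast h
        rw [le_abs]; left; linarith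
      · have : (e 0 : ℝ) + 1 ≤ d 0 := by exact_mod_cast h
        rw [le_abs]; right; linarith
    · apply inv_anti₀ (mul_pos h4 h5)
      rw [pow_two]
      have := hdU 0
      have := heU 0
      apply mul_le_mul <;> linarith
    · positivity
    · positivity
  | succ n ih =>
    intro d e U hd he hdU heU hag hne
    obtain ⟨-, -, hd3⟩ := XX_spec d hd
    obtain ⟨-, -, he3⟩ := XX_spec e he
    obtain ⟨hd1, hd2, -⟩ := XX_spec (fun k => d (k + 1)) (fun k => hd _)
    obtain ⟨he1, he2, -⟩ := XX_spec (fun k => e (k + 1)) (fun k => he _)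
    have h := ih (fun k => d (k + 1)) (fun k => e (k + 1)) (fun k => U (k + 1)) (fun k => hd _)
      (fun k => he _) (fun k => hdU _) (fun k => heU _) (fun k hk => hag _ (by omega)) hne
    have h2 : (2:ℝ) ≤ d 0 := by exact_mod_cast hd 0
    rw [hd3, he3, ← hag 0 (by omega), f_dist (by linarith) hd1 he1, Finset.prod_range_succ',
      ← mul_assoc, div_eq_mul_inv]
    have := hdU 0
    apply mul_le_mul h _ (by positivity) (abs_nonneg _)
    apply inv_anti₀ (by positivity)
    rw [pow_two]
    apply mul_le_mul <;> linarith

/-- Mixed radix remainders. -/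
noncomputable def yseq (m : ℕ → ℕ) (y : ℝ) : ℕ → ℝ
  | 0 => y
  | k + 1 => Int.fract ((m k : ℝ) * yseq m y k)

/-- Mixed radix digits. -/
noncomputable def bdig (m : ℕ → ℕ) (y : ℝ) (k : ℕ) : ℕ := ⌊(m k : ℝ) * yseq m y k⌋₊

lemma yseq_mem (m : ℕ → ℕ) {y : ℝ} (hy : y ∈ Ico (0:ℝ) 1) (k : ℕ) : yseq m y k ∈ Ico (0:ℝ) 1 := by
  cases k with
  | zero => exact hy
  | succ k => exact ⟨Int.fract_nonneg _, Int.fract_lt_one _⟩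

lemma bdig_lt (m : ℕ → ℕ) (hm : ∀ k, 1 ≤ m k) {y : ℝ} (hy : y ∈ Ico (0:ℝ) 1) (k : ℕ) :
    bdig m y k < m k := by
  have h := yseq_mem m hy k
  have h1 : (0:ℝ) < m k := by exact_mod_cast hm k
  rw [bdig, Nat.floor_lt (mul_nonneg h1.le h.1)]
  nlinarith [h.2]

lemma y_close (m : ℕ → ℕ) {y z : ℝ} (hy : y ∈ Ico (0:ℝ) 1)
    (hz : z ∈ Ico (0:ℝ) 1) (n : ℕ) (hag : ∀ k < n, bdig m y k = bdig m z k) :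
    |y - z| * ∏ k ∈ Finset.range n, (m k : ℝ) = |yseq m y n - yseq m z n| := by
  induction n with
  | zero => simp [yseq]
  | succ n ih =>
    rw [Finset.prod_range_succ, ← mul_assoc, ih (fun k hk => hag k (by omega))]
    have h := hag n (by omega)
    have h1 := yseq_mem m hy n
    have h2 := yseq_mem m hz n
    have e : ∀ w : ℝ, w ∈ Ico (0:ℝ) 1 →
        yseq m w (n + 1) = (m n : ℝ) * yseq m w n - bdig m w n := by
      intro w hw
      rw [yseq, bdig, natCast_floor_eq_intCast_floor
        (mul_nonneg (Nat.cast_nonneg _) (yseq_mem m hw n).1)]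
      rfl
    rw [e y hy, e z hz, h, sub_sub_sub_cancel_right, ← mul_sub, abs_mul, Nat.abs_cast, mul_comm]

lemma y_close' (m : ℕ → ℕ) (hm : ∀ k, 1 ≤ m k) {y z : ℝ} (hy : y ∈ Ico (0:ℝ) 1)
    (hz : z ∈ Ico (0:ℝ) 1) (n : ℕ) (hag : ∀ k < n, bdig m y k = bdig m z k) :
    |y - z| ≤ ∏ k ∈ Finset.range n, (m k : ℝ)⁻¹ := by
  have h := y_close m hy hz n hag
  have h1 := yseq_mem m hy n
  have h2 := yseq_mem m hz n
  have h3 : |yseq m y n - yseq m z n| ≤ 1 := by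
    rw [abs_le]; constructor <;> linarith [h1.1, h1.2, h2.1, h2.2]
  have hp : 0 < ∏ k ∈ Finset.range n, (m k : ℝ) :=
    Finset.prod_pos fun k _ => by exact_mod_cast hm k
  rw [Finset.prod_inv_distrib, ← one_div, le_div_iff₀ hp, h]
  exact h3

lemma anti_holder {g : ℝ → ℝ} {S : Set ℝ} {B : ℝ} {s : NNReal} (hs : 0 < s)
    (h : ∀ y ∈ S, ∀ z ∈ S, |y - z| ≤ B * |g y - g z| ^ (s : ℝ)) :
    dimH S ≤ dimH (g '' S) / s := by
  have hs' : (0:ℝ) < s := hs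
  have hinj : InjOn g S := by
    intro y hy z hz hyz
    have := h y hy z hz
    rw [hyz, sub_self, abs_zero, Real.zero_rpow hs'.ne', mul_zero] at this
    exact sub_eq_zero.1 (abs_nonpos_iff.1 this)
  have hl := hinj.leftInvOn_invFunOn
  have him : Function.invFunOn g S '' (g '' S) = S := hl.image_image
  have hH : HolderOnWith B.toNNReal s (Function.invFunOn g S) (g '' S) := by
    rintro _ ⟨y, hy, rfl⟩ _ ⟨z, hz, rfl⟩
    rw [hl hy, hl hz, edist_dist, edist_dist, Real.dist_eq, Real.dist_eq,
      ENNReal.ofReal_rpow_of_nonneg (abs_nonneg _) hs'.le]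
    change _ ≤ ENNReal.ofReal B * _
    rw [← ENNReal.ofReal_mul' (by positivity)]
    exact ENNReal.ofReal_le_ofReal (h y hy z hz)
  have := hH.dimH_image_le hs
  rwa [him] at this

lemma ratio_bound (α s : ℝ) (hs : 0 < s) (hα : 1 < α) (h : 2 * α * s < α - 1) :
    Tendsto (fun n : ℕ => (∏ k ∈ Finset.range n, (2 * ((k : ℝ) + 2) ^ (-(α - 1)))) /
      (1 / 2 * ∏ k ∈ Finset.range (n + 1), ((2 * ((k : ℝ) + 3) ^ α) ^ 2)⁻¹) ^ s) atTop (nhds 0) := by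
  apply Summable.tendsto_atTop_zero
  apply summable_of_ratio_norm_eventually_le (r := 1 / 2) (by norm_num)
  have hlim : Tendsto (fun n : ℕ => 2 * ((2 * (2:ℝ) ^ α) ^ 2) ^ s *
      ((n : ℝ) + 2) ^ (-((α - 1) - 2 * α * s))) atTop (nhds 0) := by
    have h1 : Tendsto (fun n : ℕ => (n : ℝ) + 2) atTop atTop :=
      tendsto_atTop_add_const_right _ _ tendsto_natCast_atTop_atTop
    have := (tendsto_rpow_neg_atTop (y := (α - 1) - 2 * α * s) (by linarith)).comp h1
    simpa [Function.comp_def] using this.const_mul (2 * ((2 * (2:ℝ) ^ α) ^ 2) ^ s)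
  filter_upwards [hlim.eventually_le_const (by norm_num : (0:ℝ) < 1 / 2)] with n hn
  rw [Finset.prod_range_succ _ n, Finset.prod_range_succ _ (n + 1)]
  set P := ∏ k ∈ Finset.range n, (2 * ((k : ℝ) + 2) ^ (-(α - 1)))
  set Q := ∏ k ∈ Finset.range (n + 1), ((2 * ((k : ℝ) + 3) ^ α) ^ 2)⁻¹
  have hP : 0 < P := Finset.prod_pos fun k _ => by positivity
  have hQ : 0 < Q := Finset.prod_pos fun k _ => by positivity
  have h4 : (0:ℝ) < (n : ℝ) + 2 := by positivity
  rw [Real.norm_of_nonneg (by positivity), Real.norm_of_nonneg (by positivity), ← mul_assoc (1 / 2 : ℝ),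
    Real.mul_rpow (by positivity) (by positivity), Real.inv_rpow (by positivity)]
  have hkey : (2 * ((n : ℝ) + 2) ^ (-(α - 1))) * ((2 * (((n + 1 : ℕ) : ℝ) + 3) ^ α) ^ 2) ^ s ≤ 1 / 2 := by
    refine le_trans ?_ hn
    have e1 : ((2 * (((n + 1 : ℕ) : ℝ) + 3) ^ α) ^ 2) ^ s ≤
        ((2 * (2:ℝ) ^ α) ^ 2) ^ s * ((n : ℝ) + 2) ^ (2 * α * s) := by
      have : ((n : ℝ) + 2) ^ (2 * α * s) = ((((n : ℝ) + 2) ^ α) ^ 2) ^ s := by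
        rw [← Real.rpow_natCast, ← Real.rpow_mul h4.le, ← Real.rpow_mul h4.le]
        congr 1; push_cast; ring
      rw [this, ← Real.mul_rpow (by positivity) (by positivity), ← mul_pow, mul_assoc,
        ← Real.mul_rpow (by positivity) (by positivity)]
      gcongr
      push_cast; linarith
    calc _ ≤ (2 * ((n : ℝ) + 2) ^ (-(α - 1))) * (((2 * (2:ℝ) ^ α) ^ 2) ^ s * ((n : ℝ) + 2) ^ (2 * α * s)) := by
          gcongr
      _ = 2 * ((2 * (2:ℝ) ^ α) ^ 2) ^ s * (((n : ℝ) + 2) ^ (-(α - 1)) * ((n : ℝ) + 2) ^ (2 * α * s)) := by ring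
      _ = _ := by
          rw [← Real.rpow_add h4]; congr 2; ring
  rw [show P * (2 * ((n : ℝ) + 2) ^ (-(α - 1))) / ((1 / 2 * Q) ^ s *
    (((2 * (((n + 1 : ℕ) : ℝ) + 3) ^ α) ^ 2) ^ s)⁻¹) =
    ((2 * ((n : ℝ) + 2) ^ (-(α - 1))) * ((2 * (((n + 1 : ℕ) : ℝ) + 3) ^ α) ^ 2) ^ s) *
    (P / (1 / 2 * Q) ^ s) by field_simp]
  gcongr

/-- Left endpoints of the digit ranges. -/
noncomputable def bas (α : ℝ) (k : ℕ) : ℕ := ⌈((k : ℝ) + 2) ^ α⌉₊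

/-- Number of admissible digits. -/
noncomputable def mm (α : ℝ) (k : ℕ) : ℕ := bas α (k + 1) - bas α k

lemma bas_gap {α : ℝ} (hα : 1 < α) (k : ℕ) :
    ((k : ℝ) + 2) ^ α + ((k : ℝ) + 2) ^ (α - 1) ≤ ((k : ℝ) + 3) ^ α := by
  have hk : (0:ℝ) < (k : ℝ) + 2 := by positivity
  have h := one_add_mul_self_le_rpow_one_add (s := 1 / ((k : ℝ) + 2))
    (le_trans (by norm_num) (by positivity : (0:ℝ) ≤ 1 / ((k : ℝ) + 2))) hα.le
  have e : (k : ℝ) + 3 = ((k : ℝ) + 2) * (1 + 1 / ((k : ℝ) + 2)) := by field_simp; ring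
  rw [e, Real.mul_rpow hk.le (by positivity), Real.rpow_sub_one hk.ne']
  have h3 : 0 < ((k : ℝ) + 2) ^ α := by positivity
  calc _ = ((k : ℝ) + 2) ^ α * (1 + 1 * (1 / ((k : ℝ) + 2))) := by field_simp
    _ ≤ ((k : ℝ) + 2) ^ α * (1 + α * (1 / ((k : ℝ) + 2))) := by gcongr
    _ ≤ _ := by gcongr

lemma bas_succ_cast (α : ℝ) (k : ℕ) : bas α (k + 1) = ⌈((k : ℝ) + 3) ^ α⌉₊ := by
  rw [bas]; congr 2; push_cast; ring

lemma one_le_pow_aux {α : ℝ} (hα : 1 < α) (k : ℕ) : (1:ℝ) ≤ ((k : ℝ) + 2) ^ (α - 1) :=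
  Real.one_le_rpow (by linarith [Nat.cast_nonneg (α := ℝ) k]) (by linarith)

lemma bas_lt {α : ℝ} (hα : 1 < α) (k : ℕ) : bas α k + 1 ≤ bas α (k + 1) := by
  rw [bas_succ_cast, bas, ← Nat.ceil_add_one (by positivity)]
  apply Nat.ceil_le_ceil
  linarith [bas_gap hα k, one_le_pow_aux hα k]

lemma mm_pos {α : ℝ} (hα : 1 < α) (k : ℕ) : 1 ≤ mm α k := by
  have := bas_lt hα k
  rw [mm]; omega

lemma bas_ge {α : ℝ} (hα : 1 < α) (k : ℕ) : 2 ≤ bas α k := by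
  have h : (2:ℝ) ≤ ((k : ℝ) + 2) ^ α := by
    have h0 : (1:ℝ) ≤ (k : ℝ) + 2 := by linarith [Nat.cast_nonneg (α := ℝ) k]
    have := Real.rpow_le_rpow_of_exponent_le h0 hα.le
    rw [Real.rpow_one] at this
    linarith [Nat.cast_nonneg (α := ℝ) k]
  have : (2:ℝ) ≤ (bas α k : ℝ) := h.trans (Nat.le_ceil (((k : ℝ) + 2) ^ α))
  exact_mod_cast this

lemma mm_inv {α : ℝ} (hα : 1 < α) (k : ℕ) :
    ((mm α k : ℕ) : ℝ)⁻¹ ≤ 2 * ((k : ℝ) + 2) ^ (-(α - 1)) := by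
  have h1 : (1:ℝ) ≤ mm α k := by exact_mod_cast mm_pos hα k
  have hc : (mm α k : ℝ) = bas α (k + 1) - bas α k := by
    rw [mm, Nat.cast_sub]; have := bas_lt hα k; omega
  have h2 : ((k : ℝ) + 3) ^ α ≤ bas α (k + 1) := by rw [bas_succ_cast]; exact Nat.le_ceil _
  have h3 : (bas α k : ℝ) < ((k : ℝ) + 2) ^ α + 1 := Nat.ceil_lt_add_one (by positivity)
  have h4 := bas_gap hα k
  have hp : (0:ℝ) < ((k : ℝ) + 2) ^ (α - 1) := by positivity
  rw [Real.rpow_neg (by positivity), ← div_eq_mul_inv, inv_le_comm₀ (by linarith) (by positivity),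
    inv_div]
  linarith

/-- Digits of the point associated with `y`. -/
noncomputable def dd (α y : ℝ) (k : ℕ) : ℕ := bas α k + bdig (mm α) y k

lemma dd_lt {α : ℝ} (hα : 1 < α) {y : ℝ} (hy : y ∈ Ico (0:ℝ) 1) (k : ℕ) :
    dd α y k + 1 ≤ bas α (k + 1) := by
  have h := bdig_lt (mm α) (mm_pos hα) hy k
  have := bas_lt hα k
  rw [mm] at h
  rw [dd]; omega

lemma dd_ge {α : ℝ} (hα : 1 < α) (y : ℝ) (k : ℕ) : 2 ≤ dd α y k := by
  have := bas_ge hα k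
  rw [dd]; omega

lemma dd_upper {α : ℝ} (hα : 1 < α) {y : ℝ} (hy : y ∈ Ico (0:ℝ) 1) (k : ℕ) :
    (dd α y k : ℝ) + 1 ≤ 2 * ((k : ℝ) + 3) ^ α := by
  have h1 : (dd α y k : ℝ) + 1 ≤ bas α (k + 1) := by exact_mod_cast dd_lt hα hy k
  have h3 : (bas α (k + 1) : ℝ) < ((k : ℝ) + 3) ^ α + 1 := by
    rw [bas_succ_cast]; exact Nat.ceil_lt_add_one (by positivity)
  have h0 : (1:ℝ) ≤ ((k : ℝ) + 3) ^ α :=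
    Real.one_le_rpow (by linarith [Nat.cast_nonneg (α := ℝ) k]) (by linarith)
  linarith

lemma dd_mono {α : ℝ} (hα : 1 < α) {y : ℝ} (hy : y ∈ Ico (0:ℝ) 1) : Monotone (dd α y) := by
  refine monotone_nat_of_le_succ fun k => ?_
  have := dd_lt hα hy k
  have h2 : bas α (k + 1) ≤ dd α y (k + 1) := by rw [dd]; omega
  omega

lemma log_ratio (c : ℝ) : Tendsto (fun n : ℕ => Real.log ((n : ℝ) + c) / Real.log n) atTop
    (nhds 1) := by
  have h1 := (Real.tendsto_log_comp_add_sub_log c).comp tendsto_natCast_atTop_atTop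
  have hlog : Tendsto (fun n : ℕ => Real.log n) atTop atTop :=
    Real.tendsto_log_atTop.comp tendsto_natCast_atTop_atTop
  have h2 := (h1.div_atTop hlog).const_add 1
  rw [add_zero] at h2
  refine h2.congr' ?_
  filter_upwards [hlog.eventually_gt_atTop 0] with n hn
  simp only [Function.comp]
  field_simp
  ring

lemma mem_E (ψ : ℕ → ℝ) (hψpos : ∀ n, 0 < ψ n) (α : ℝ) (hα1 : 1 < α)
    (hα : Tendsto (fun n : ℕ => ψ n / Real.log n) atTop (nhds α)) {y : ℝ}
    (hy : y ∈ Ico (0:ℝ) 1) : XX (dd α y) ∈ {x | x ∈ Lam ∧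
        Filter.limsup (fun n : ℕ => ((Real.log (cfA n x) / ψ n : ℝ) : EReal)) atTop =
          (1 : EReal)} := by
  have hd := dd_ge hα1 y
  have hα0 : 0 < α := by linarith
  refine ⟨mem_Lam_iff.2 ⟨XX_mem _ hd, ?_⟩, ?_⟩
  · have : (fun k => dig k (XX (dd α y))) = dd α y := funext fun k => XX_dig k _ hd
    rw [this]; exact dd_mono hα1 hy
  · apply Tendsto.limsup_eq
    rw [← EReal.coe_one]
    refine (continuous_coe_real_ereal.tendsto 1).comp ?_
    have hlog : Tendsto (fun n : ℕ => Real.log n) atTop atTop :=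
      Real.tendsto_log_atTop.comp tendsto_natCast_atTop_atTop
    have hlim : ∀ c : ℝ, Tendsto (fun n : ℕ => α * Real.log ((n : ℝ) + c) / ψ n) atTop (nhds 1) := by
      intro c
      have h1 := ((log_ratio c).const_mul α).div hα hα0.ne'
      rw [mul_one, div_self hα0.ne'] at h1
      refine h1.congr' ?_
      filter_upwards [hlog.eventually_gt_atTop 0] with n hn
      have := (hψpos n).ne'
      simp only [Pi.div_apply]
      field_simp
    refine tendsto_of_tendsto_of_tendsto_of_le_of_le' (hlim 1) (hlim 2) ?_ ?_
    · filter_upwards [eventually_gt_atTop 0] with n hn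
      obtain ⟨k, rfl⟩ : ∃ k, n = k + 1 := ⟨n - 1, by omega⟩
      rw [cfA_succ, XX_dig k _ hd]
      have := hψpos (k + 1)
      gcongr
      rw [← Real.log_rpow (by positivity)]
      apply Real.log_le_log (by positivity)
      have h1 : ((k : ℝ) + 2) ^ α ≤ bas α k := Nat.le_ceil _
      have h2 : (bas α k : ℝ) ≤ dd α y k := by rw [dd]; push_cast; linarith [Nat.cast_nonneg (α := ℝ) (bdig (mm α) y k)]
      refine le_trans (le_of_eq ?_) (h1.trans h2)
      push_cast; congr 1; ring
    · filter_upwards [eventually_gt_atTop 0] with n hn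
      obtain ⟨k, rfl⟩ : ∃ k, n = k + 1 := ⟨n - 1, by omega⟩
      rw [cfA_succ, XX_dig k _ hd]
      have := hψpos (k + 1)
      have h0 : (0:ℝ) < dd α y k := by
        have := hd k
        exact_mod_cast (by omega : 0 < dd α y k)
      gcongr
      rw [← Real.log_rpow (by positivity)]
      apply Real.log_le_log h0
      have h1 : (dd α y k : ℝ) + 1 ≤ bas α (k + 1) := by exact_mod_cast dd_lt hα1 hy k
      have h3 : (bas α (k + 1) : ℝ) < ((k : ℝ) + 3) ^ α + 1 := by
        rw [bas_succ_cast]; exact Nat.ceil_lt_add_one (by positivity)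
      have h4 : ((k + 1 : ℕ) : ℝ) + 2 = (k : ℝ) + 3 := by push_cast; ring
      rw [h4]; linarith

lemma holder_XX (α : ℝ) (hα1 : 1 < α) (s : ℝ) (hs : 0 < s) (h : 2 * α * s < α - 1) :
    ∃ B : ℝ, ∀ y ∈ Ico (0:ℝ) 1, ∀ z ∈ Ico (0:ℝ) 1,
      |y - z| ≤ B * |XX (dd α y) - XX (dd α z)| ^ s := by
  have hR := ratio_bound α s hs hα1 h
  obtain ⟨B, hB⟩ := hR.bddAbove_range
  set P : ℕ → ℝ := fun n => ∏ k ∈ Finset.range n, (2 * ((k : ℝ) + 2) ^ (-(α - 1))) with hP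
  set Q : ℕ → ℝ := fun n =>
    1 / 2 * ∏ k ∈ Finset.range (n + 1), ((2 * ((k : ℝ) + 3) ^ α) ^ 2)⁻¹ with hQ
  have hQ0 : ∀ n, 0 < Q n := fun n =>
    mul_pos (by norm_num) (Finset.prod_pos fun k _ => by positivity)
  have hP0 : ∀ n, 0 < P n := fun n => Finset.prod_pos fun k _ => by positivity
  have hPB : ∀ n, P n ≤ B * Q n ^ s := by
    intro n
    rw [← div_le_iff₀ (Real.rpow_pos_of_pos (hQ0 n) s)]
    exact hB ⟨n, rfl⟩
  have hB0 : 0 ≤ B := le_trans (div_pos (hP0 0) (Real.rpow_pos_of_pos (hQ0 0) s)).le (hB ⟨0, rfl⟩)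
  have hclose : ∀ y ∈ Ico (0:ℝ) 1, ∀ z ∈ Ico (0:ℝ) 1, ∀ n,
      (∀ k < n, dd α y k = dd α z k) → |y - z| ≤ P n := by
    intro y hy z hz n hag
    refine (y_close' (mm α) (mm_pos hα1) hy hz n fun k hk => ?_).trans ?_
    · have := hag k hk
      simp only [dd] at this; omega
    · apply Finset.prod_le_prod
      · intros; positivity
      · intro k _; exact mm_inv hα1 k
  refine ⟨B, fun y hy z hz => ?_⟩
  by_cases hall : ∀ k, dd α y k = dd α z k
  · have hP1 : ∀ n, P n ≤ P n / Q n ^ s := by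
      intro n
      apply le_div_self (hP0 n).le (Real.rpow_pos_of_pos (hQ0 n) s)
      apply Real.rpow_le_one (hQ0 n).le _ hs.le
      have : ∏ k ∈ Finset.range (n + 1), ((2 * ((k : ℝ) + 3) ^ α) ^ 2)⁻¹ ≤ 1 := by
        apply Finset.prod_le_one
        · intros; positivity
        · intro k _
          apply inv_le_one_of_one_le₀
          apply one_le_pow₀
          have h0 : (1:ℝ) ≤ ((k : ℝ) + 3) ^ α :=
            Real.one_le_rpow (by linarith [Nat.cast_nonneg (α := ℝ) k]) (by linarith)
          linarith
      simp only [hQ]; linarith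
    have : |y - z| ≤ 0 := ge_of_tendsto' hR fun n =>
      (hclose y hy z hz n fun k _ => hall k).trans (hP1 n)
    exact this.trans (by positivity)
  · push Not at hall
    classical
    have hn := Nat.find_spec hall
    have hlt : ∀ k < Nat.find hall, dd α y k = dd α z k := fun k hk => by
      have := Nat.find_min hall hk
      push Not at this; exact this
    set n := Nat.find hall
    have hsep := XX_sep n (dd α y) (dd α z) (fun k => 2 * ((k : ℝ) + 3) ^ α) (dd_ge hα1 y)
      (dd_ge hα1 z) (dd_upper hα1 hy) (dd_upper hα1 hz) hlt hn
    refine (hclose y hy z hz n hlt).trans ((hPB n).trans ?_)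
    have := (hQ0 n).le
    gcongr

lemma lower (ψ : ℕ → ℝ) (hψpos : ∀ n, 0 < ψ n) (α : ℝ) (hα1 : 1 < α)
    (hα : Tendsto (fun n : ℕ => ψ n / Real.log n) atTop (nhds α)) :
      ENNReal.ofReal ((α - 1) / (2 * α)) ≤ dimH {x | x ∈ Lam ∧
        Filter.limsup (fun n : ℕ => ((Real.log (cfA n x) / ψ n : ℝ) : EReal)) atTop =
          (1 : EReal)} := by
  apply le_of_forall_lt_imp_le_of_dense
  intro a ha
  obtain ⟨s, hs1, hs2⟩ := ENNReal.lt_iff_exists_nnreal_btwn.1 ha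
  refine hs1.le.trans ?_
  have hs0 : 0 < s := by
    have : (0 : ENNReal) < s := lt_of_le_of_lt (zero_le) hs1
    exact_mod_cast this
  have hs4 : (s : ℝ) < (α - 1) / (2 * α) := by
    rw [← ENNReal.ofReal_coe_nnreal, ENNReal.ofReal_lt_ofReal_iff_of_nonneg s.coe_nonneg] at hs2
    exact hs2
  rw [lt_div_iff₀ (by linarith)] at hs4
  obtain ⟨B, hB⟩ := holder_XX α hα1 s hs0 (by linarith)
  have h := anti_holder hs0 hB
  have h1 : dimH (Ico (0:ℝ) 1) = 1 := by
    have := Real.dimH_of_nonempty_interior (s := Ico (0:ℝ) 1) (by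
      rw [interior_Ico]; exact nonempty_Ioo.2 one_pos)
    simpa using this
  rw [h1, ENNReal.le_div_iff_mul_le (by left; exact_mod_cast hs0.ne') (by left; simp), one_mul] at h
  refine h.trans (dimH_mono ?_)
  rintro _ ⟨y, hy, rfl⟩
  exact mem_E ψ hψpos α hα1 hα hy

/-- If `ψ(n)/log n → α` with `α ≥ 1`, then `E_sup(Λ,ψ)` has Hausdorff dimension
`(α-1)/(2α)`. -/
theorem dimH_Esup_Lam (ψ : ℕ → ℝ) (hψpos : ∀ n, 0 < ψ n) (α : ℝ) (hα1 : 1 ≤ α)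
    (hα : Tendsto (fun n : ℕ => ψ n / Real.log n) atTop (nhds α)) :
    dimH {x | x ∈ Lam ∧
        Filter.limsup (fun n : ℕ => ((Real.log (cfA n x) / ψ n : ℝ) : EReal)) atTop =
          (1 : EReal)} =
      ENNReal.ofReal ((α - 1) / (2 * α)) := by

  refine le_antisymm (upper ψ hψpos α hα1 hα) ?_
  rcases hα1.eq_or_lt with h | h
  · rw [← h]; simp
  · exact lower ψ hψpos α h hα
end

section
/- Let ψ : ℕ → ℝ⁺ be non-decreasing with ψ(n)/(log n) → ∞ as n → ∞, and set C = 1 + limsup_{n→∞} ψ(n+1)/(ψ(1)+⋯+ψ(n)) ∈ [1,∞]. Then E(Λ,ψ) = {x ∈ Λ : lim_{n→∞} (log a_n(x))/ψ(n) = 1} has Hausdorff dimension 1/(C+1). -/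
open Filter MeasureTheory Set
open scoped ENNReal

namespace CFDim

/-- iterates of the Gauss map -/
noncomputable def T (n : ℕ) (x : ℝ) : ℝ := gaussMap^[n] x

/-- digits indexed from zero -/
noncomputable def dg (n : ℕ) (x : ℝ) : ℕ := ⌊(T n x)⁻¹⌋₊

lemma cfA_succ (n : ℕ) (x : ℝ) : cfA (n + 1) x = dg n x := rfl

lemma T_succ (n : ℕ) (x : ℝ) : T (n + 1) x = gaussMap (T n x) := by
  simp [T, Function.iterate_succ_apply']

lemma T_inv {n : ℕ} {x : ℝ} (h : T n x ∈ Ioo (0:ℝ) 1) :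
    (T n x)⁻¹ = dg n x + T (n + 1) x := by
  have h0 : 0 ≤ (T n x)⁻¹ := inv_nonneg.2 h.1.le
  rw [T_succ, gaussMap, dg, natCast_floor_eq_intCast_floor h0]
  exact (Int.floor_add_fract _).symm

lemma dg_pos {n : ℕ} {x : ℝ} (h : T n x ∈ Ioo (0:ℝ) 1) : 1 ≤ dg n x := by
  rw [dg, Nat.one_le_floor_iff]
  exact (one_le_inv₀ h.1).2 h.2.le

lemma T_eq {n : ℕ} {x : ℝ} (h : T n x ∈ Ioo (0:ℝ) 1) :
    T n x = 1 / (dg n x + T (n + 1) x) := by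
  rw [← T_inv h]; simp

lemma Lam_T {x : ℝ} (hx : x ∈ Lam) (n : ℕ) : T n x ∈ Ioo (0:ℝ) 1 := by
  have hmono : Monotone (fun n => dg n x) :=
    monotone_nat_of_le_succ (fun n => hx.2 (n + 1) (by omega))
  have h0 : 1 ≤ dg 0 x := dg_pos hx.1
  rcases n with _ | n
  · exact hx.1
  · have h1 : 1 ≤ dg (n + 1) x := h0.trans (hmono (Nat.zero_le _))
    have h2 : T (n + 1) x = Int.fract (T n x)⁻¹ := T_succ n x
    have h3 : 0 ≤ T (n + 1) x := h2 ▸ Int.fract_nonneg _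
    have h4 : T (n + 1) x < 1 := h2 ▸ Int.fract_lt_one _
    refine ⟨lt_of_le_of_ne h3 ?_, h4⟩
    intro h
    rw [dg, ← h] at h1
    simp at h1

lemma T_le {n : ℕ} {x : ℝ} (h : ∀ i, T i x ∈ Ioo (0:ℝ) 1) : T n x ≤ 1 / dg n x := by
  rw [T_eq (h n)]
  have := dg_pos (h n)
  have h1 : (1:ℝ) ≤ dg n x := by exact_mod_cast this
  have := (h (n+1)).1
  gcongr
  linarith

lemma dist_step {x y : ℝ} (hx : ∀ i, T i x ∈ Ioo (0:ℝ) 1) (hy : ∀ i, T i y ∈ Ioo (0:ℝ) 1)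
    (n : ℕ) : |T n x - T n y| = |((dg n y : ℝ) + T (n + 1) y) - (dg n x + T (n + 1) x)| /
      ((dg n x + T (n + 1) x) * (dg n y + T (n + 1) y)) := by
  have h1 : (0:ℝ) < dg n x + T (n + 1) x := by have := (hx (n+1)).1; positivity
  have h2 : (0:ℝ) < dg n y + T (n + 1) y := by have := (hy (n+1)).1; positivity
  rw [T_eq (hx n), T_eq (hy n), div_sub_div _ _ h1.ne' h2.ne', abs_div,
    abs_of_pos (mul_pos h1 h2)]
  simp

lemma dist_upper {x y : ℝ} (hx : ∀ i, T i x ∈ Ioo (0:ℝ) 1) (hy : ∀ i, T i y ∈ Ioo (0:ℝ) 1)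
    (n : ℕ) (h : ∀ i < n, dg i x = dg i y) :
    |x - y| * (∏ i ∈ Finset.range n, (dg i x : ℝ)) ^ 2 ≤ |T n x - T n y| := by
  induction n with
  | zero => simp [T]
  | succ n ih =>
    have ih' := ih (fun i hi => h i (by omega))
    rw [dist_step hx hy, ← h n (by omega)] at ih'
    have h1 : (1:ℝ) ≤ dg n x := by exact_mod_cast dg_pos (hx n)
    have h2 := (hx (n+1)).1
    have h3 := (hy (n+1)).1
    rw [le_div_iff₀ (by positivity)] at ih'
    rw [Finset.prod_range_succ, mul_pow, ← mul_assoc]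
    refine le_trans ?_ (ih'.trans_eq ?_)
    · gcongr
      nlinarith
    · rw [abs_sub_comm]; congr 1; ring

lemma dist_lower {x y : ℝ} (hx : ∀ i, T i x ∈ Ioo (0:ℝ) 1) (hy : ∀ i, T i y ∈ Ioo (0:ℝ) 1)
    (n : ℕ) (h : ∀ i < n, dg i x = dg i y) :
    |T n x - T n y| ≤ |x - y| * (∏ i ∈ Finset.range n, ((dg i x : ℝ) + 1)) ^ 2 := by
  induction n with
  | zero => simp [T]
  | succ n ih =>
    have ih' := ih (fun i hi => h i (by omega))
    rw [dist_step hx hy, ← h n (by omega)] at ih'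
    have h1 : (1:ℝ) ≤ dg n x := by exact_mod_cast dg_pos (hx n)
    have h2 := hx (n+1)
    have h3 := hy (n+1)
    have h2' := h2.1
    have h3' := h3.1
    have h2'' := h2.2
    have h3'' := h3.2
    rw [div_le_iff₀ (by positivity)] at ih'
    rw [Finset.prod_range_succ, mul_pow, ← mul_assoc]
    refine le_trans (le_of_eq ?_) (ih'.trans ?_)
    · rw [abs_sub_comm]; congr 1; ring
    · gcongr
      nlinarith

lemma sum_le_aux (f g : ℕ → ℝ) (N : ℕ) (h : ∀ i, N ≤ i → f i ≤ g i) :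
    ∃ c : ℝ, ∀ n, ∑ i ∈ Finset.range n, f i ≤ ∑ i ∈ Finset.range n, g i + c := by
  refine ⟨∑ i ∈ Finset.range N, |f i - g i|, fun n => ?_⟩
  rcases le_total n N with hn | hn
  · have h1 : ∑ i ∈ Finset.range n, |f i - g i| ≤ ∑ i ∈ Finset.range N, |f i - g i| :=
      Finset.sum_le_sum_of_subset_of_nonneg (Finset.range_mono hn) (fun _ _ _ => abs_nonneg _)
    have h2 : ∑ i ∈ Finset.range n, (f i - g i) ≤ ∑ i ∈ Finset.range n, |f i - g i| :=
      Finset.sum_le_sum (fun _ _ => le_abs_self _)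
    rw [Finset.sum_sub_distrib] at h2
    linarith
  · induction n, hn using Nat.le_induction with
    | base =>
      have h2 : ∑ i ∈ Finset.range N, (f i - g i) ≤ ∑ i ∈ Finset.range N, |f i - g i| :=
        Finset.sum_le_sum (fun _ _ => le_abs_self _)
      rw [Finset.sum_sub_distrib] at h2
      linarith
    | succ n hn ih =>
      rw [Finset.sum_range_succ, Finset.sum_range_succ]
      have := h n hn
      linarith

/-- The set used for covering. -/
def FF (lam ups : ℕ → ℝ) : Set ℝ :=
  {x | (∀ i, T i x ∈ Ioo (0:ℝ) 1) ∧ ∀ i, lam i ≤ Real.log (dg i x) ∧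
    Real.log (dg i x + 1) ≤ ups i}

lemma FF_zero (lam ups : ℕ → ℝ) (s : ℝ) (hs : 0 ≤ s) (φ : ℕ → ℕ)
    (h1 : Tendsto (fun n => 2 * ∑ i ∈ Finset.range (φ n), lam i + lam (φ n)) atTop atTop)
    (h2 : Tendsto (fun n => ∑ i ∈ Finset.range (φ n), ups i -
      s * (2 * ∑ i ∈ Finset.range (φ n), lam i + lam (φ n))) atTop atBot) :
    Measure.hausdorffMeasure s (FF lam ups) = 0 := by
  set D : ℕ → ℝ := fun n => 2 * ∑ i ∈ Finset.range (φ n), lam i + lam (φ n) with hD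
  set U : ℕ → ℕ := fun i => ⌊Real.exp (ups i)⌋₊ with hU
  let t : ∀ n : ℕ, (∀ i : Fin (φ n), Fin (U i)) → Set ℝ := fun n w =>
    {x | x ∈ FF lam ups ∧ ∀ i : Fin (φ n), dg i x = w i}
  have hdiam : ∀ n w, Metric.ediam (t n w) ≤ ENNReal.ofReal (Real.exp (- D n)) := by
    intro n w
    refine Metric.ediam_le fun x hx y hy => ?_
    rw [edist_dist, Real.dist_eq]
    apply ENNReal.ofReal_le_ofReal
    have hdg : ∀ i < φ n, dg i x = dg i y := fun i hi => by
      rw [hx.2 ⟨i, hi⟩, hy.2 ⟨i, hi⟩]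
    have key := dist_upper hx.1.1 hy.1.1 (φ n) hdg
    have hlow : ∀ z ∈ FF lam ups, ∀ i, Real.exp (lam i) ≤ dg i z := by
      intro z hz i
      have h1 : (1:ℝ) ≤ dg i z := by exact_mod_cast dg_pos (hz.1 i)
      rw [← Real.le_log_iff_exp_le (by linarith)]
      exact (hz.2 i).1
    have hT : ∀ z ∈ FF lam ups, T (φ n) z ≤ Real.exp (- lam (φ n)) := by
      intro z hz
      refine (T_le hz.1).trans ?_
      rw [Real.exp_neg, ← one_div]
      exact one_div_le_one_div_of_le (Real.exp_pos _) (hlow z hz _)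
    have hT2 : |T (φ n) x - T (φ n) y| ≤ Real.exp (- lam (φ n)) := by
      rw [abs_le]
      have := hT x hx.1
      have := hT y hy.1
      have := (hx.1.1 (φ n)).1
      have := (hy.1.1 (φ n)).1
      constructor <;> linarith
    have hprod : Real.exp (∑ i ∈ Finset.range (φ n), lam i) ≤
        ∏ i ∈ Finset.range (φ n), (dg i x : ℝ) := by
      rw [Real.exp_sum]
      exact Finset.prod_le_prod (fun _ _ => (Real.exp_pos _).le) (fun i _ => hlow x hx.1 i)
    have h3 : |x - y| * (Real.exp (∑ i ∈ Finset.range (φ n), lam i)) ^ 2 ≤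
        Real.exp (- lam (φ n)) := by
      refine le_trans ?_ (key.trans hT2)
      gcongr
    rw [← le_div_iff₀ (by positivity)] at h3
    refine h3.trans_eq ?_
    rw [← Real.exp_nat_mul, ← Real.exp_sub]
    congr 1
    simp only [hD]; push_cast; ring
  have hcover : ∀ n, FF lam ups ⊆ ⋃ w, t n w := by
    intro n x hx
    have hlt : ∀ i, dg i x < U i := by
      intro i
      have h4 : ((dg i x + 1 : ℕ) : ℝ) ≤ Real.exp (ups i) := by
        rw [← Real.log_le_iff_le_exp (by positivity)]
        push_cast
        exact (hx.2 i).2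
      exact Nat.le_floor h4
    refine mem_iUnion.2 ⟨fun i => ⟨dg i x, hlt i⟩, hx, fun i => rfl⟩
  have hr : Tendsto (fun n => ENNReal.ofReal (Real.exp (- D n))) atTop (nhds 0) := by
    rw [← ENNReal.ofReal_zero]
    exact ENNReal.tendsto_ofReal (Real.tendsto_exp_neg_atTop_nhds_zero.comp h1)
  have hmain := Measure.hausdorffMeasure_le_liminf_sum s (FF lam ups) (l := atTop)
    (fun n => ENNReal.ofReal (Real.exp (- D n))) hr t
    (Eventually.of_forall fun n => hdiam n) (Eventually.of_forall hcover)
  have hbound : ∀ n, ∑ w, Metric.ediam (t n w) ^ s ≤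
      ENNReal.ofReal (Real.exp (∑ i ∈ Finset.range (φ n), ups i - s * D n)) := by
    intro n
    calc ∑ w, Metric.ediam (t n w) ^ s
        ≤ ∑ w : (∀ i : Fin (φ n), Fin (U i)), ENNReal.ofReal (Real.exp (- D n)) ^ s :=
          Finset.sum_le_sum fun w _ => ENNReal.rpow_le_rpow (hdiam n w) hs
      _ = (∏ i ∈ Finset.range (φ n), U i : ℕ) * ENNReal.ofReal (Real.exp (- D n)) ^ s := by
          rw [Finset.sum_const, nsmul_eq_mul, Finset.card_univ, Fintype.card_pi]
          simp [Finset.prod_range]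
      _ ≤ ENNReal.ofReal (Real.exp (∑ i ∈ Finset.range (φ n), ups i)) *
          ENNReal.ofReal (Real.exp (- (s * D n))) := by
          gcongr
          · rw [← ENNReal.ofReal_natCast]
            apply ENNReal.ofReal_le_ofReal
            push_cast
            rw [Real.exp_sum]
            exact Finset.prod_le_prod (fun _ _ => by positivity)
              (fun i _ => Nat.floor_le (Real.exp_pos _).le)
          · rw [ENNReal.ofReal_rpow_of_nonneg (Real.exp_pos _).le hs, ← Real.exp_mul]
            apply le_of_eq; congr 2; ring
      _ = _ := by
          rw [← ENNReal.ofReal_mul (Real.exp_pos _).le, ← Real.exp_add]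
          congr 2
  have hz : Tendsto (fun n => ∑ w, Metric.ediam (t n w) ^ s) atTop (nhds 0) := by
    refine tendsto_of_tendsto_of_tendsto_of_le_of_le tendsto_const_nhds ?_
      (fun _ => zero_le) hbound
    rw [← ENNReal.ofReal_zero]
    exact ENNReal.tendsto_ofReal (Real.tendsto_exp_atBot.comp h2)
  rw [hz.liminf_eq] at hmain
  exact le_antisymm hmain zero_le

lemma sum_Icc_eq (ψ : ℕ → ℝ) (n : ℕ) :
    ∑ k ∈ Finset.Icc 1 n, ψ k = ∑ i ∈ Finset.range n, ψ (i + 1) := by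
  induction n with
  | zero => simp
  | succ n ih => rw [Finset.sum_Icc_succ_top (by omega), ih, Finset.sum_range_succ]

lemma log_small (ψ : ℕ → ℝ)
    (hψ : Tendsto (fun n : ℕ => ψ n / Real.log n) atTop atTop) (ε : ℝ) (hε : 0 < ε) :
    ∀ᶠ i : ℕ in atTop, Real.log (2 * (i + 2)) ≤ ε * ψ (i + 1) := by
  have h1 := (tendsto_add_atTop_nat 1).eventually (hψ.eventually_ge_atTop (3 / ε))
  filter_upwards [h1, eventually_ge_atTop 1] with i hi hi1
  have hi2 : (1:ℝ) ≤ i := by exact_mod_cast hi1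
  have hlog : 0 < Real.log ((i + 1 : ℕ) : ℝ) := by
    apply Real.log_pos
    push_cast; linarith
  rw [div_le_div_iff₀ hε hlog] at hi
  have h2 : Real.log (2 * (i + 2)) ≤ 3 * Real.log ((i + 1 : ℕ) : ℝ) := by
    have : (3:ℝ) * Real.log ((i + 1 : ℕ) : ℝ) = Real.log (((i + 1 : ℕ) : ℝ) ^ 3) := by
      rw [Real.log_pow]; norm_num
    rw [this]
    apply Real.log_le_log (by positivity)
    push_cast
    nlinarith [mul_nonneg (by linarith : (0:ℝ) ≤ i) (by linarith : (0:ℝ) ≤ i - 1)]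
  linarith

lemma S_tendsto (ψ : ℕ → ℝ) (hψpos : ∀ n, 0 < ψ n) (hmono : Monotone ψ) :
    Tendsto (fun n => ∑ i ∈ Finset.range n, ψ (i + 1)) atTop atTop := by
  refine tendsto_atTop_mono (f := fun n : ℕ => (n : ℝ) * ψ 0) ?_
    (tendsto_natCast_atTop_atTop.atTop_mul_const (hψpos 0))
  intro n
  calc (n : ℝ) * ψ 0 = ∑ i ∈ Finset.range n, ψ 0 := by simp
    _ ≤ _ := Finset.sum_le_sum fun i _ => hmono (Nat.zero_le _)

lemma upper_bound (ψ : ℕ → ℝ) (hψpos : ∀ n, 0 < ψ n) (hmono : Monotone ψ)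
    (hψ : Tendsto (fun n : ℕ => ψ n / Real.log n) atTop atTop)
    (s : NNReal) (r : ℝ) (hr : 0 ≤ r) (hsr : 1 < s * (2 + r))
    (hfreq : ∃ᶠ n : ℕ in atTop, r * ∑ i ∈ Finset.range n, ψ (i + 1) ≤ ψ (n + 1)) :
    dimH {x | x ∈ Lam ∧
        Tendsto (fun n : ℕ => Real.log (cfA n x) / ψ n) atTop (nhds 1)} ≤ s := by
  set p : ℕ → ℝ := fun i => ψ (i + 1) with hp
  have hppos : ∀ i, 0 < p i := fun i => hψpos _
  set σ : ℝ := s * (2 + r) with hσ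
  obtain ⟨ε, hε, hε1, hεσ⟩ : ∃ ε : ℝ, 0 < ε ∧ ε < 1 ∧ (1 + ε) - σ * (1 - ε) < 0 := by
    refine ⟨(σ - 1) / (2 * (σ + 1)), by apply div_pos <;> linarith, ?_, ?_⟩
    · rw [div_lt_one (by linarith)]; linarith
    · have : (σ - 1) / (2 * (σ + 1)) * (σ + 1) = (σ - 1) / 2 := by
        field_simp
      nlinarith
  obtain ⟨φ, hφ, hφr⟩ := extraction_of_frequently_atTop hfreq
  have hs0 : (0:ℝ) ≤ s := s.coe_nonneg
  let lam : ℕ → ℕ → ℝ := fun N i => if i < N then 0 else (1 - ε) * p i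
  let ups : ℕ → ℕ → ℕ → ℝ := fun N K i => if i < N then (K : ℝ) else (1 + ε) * p i
  have hS : Tendsto (fun n => ∑ i ∈ Finset.range (φ n), p i) atTop atTop :=
    (S_tendsto ψ hψpos hmono).comp hφ.tendsto_atTop
  have hzero : ∀ N K, dimH (FF (lam N) (ups N K)) ≤ s := by
    intro N K
    obtain ⟨c1, hc1⟩ := sum_le_aux (fun i => (1 - ε) * p i) (lam N) N
      (fun i hi => by simp [lam, not_lt.2 hi])
    obtain ⟨c2, hc2⟩ := sum_le_aux (ups N K) (fun i => (1 + ε) * p i) N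
      (fun i hi => by simp [ups, not_lt.2 hi])
    simp only [← Finset.mul_sum] at hc1 hc2
    have hlast : ∀ᶠ n in atTop, lam N (φ n) = (1 - ε) * p (φ n) := by
      filter_upwards [hφ.tendsto_atTop.eventually_ge_atTop N] with n hn
      simp [lam, not_lt.2 hn]
    apply dimH_le_of_hausdorffMeasure_ne_top
    rw [FF_zero (lam N) (ups N K) s hs0 φ]
    · simp
    · have : Tendsto (fun n => 2 * (1 - ε) * ∑ i ∈ Finset.range (φ n), p i + (- 2 * c1))
          atTop atTop :=
        tendsto_atTop_add_const_right _ _ (hS.const_mul_atTop (by linarith))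
      refine tendsto_atTop_mono' _ ?_ this
      filter_upwards [hlast] with n hn
      rw [hn]
      have h1 := hc1 (φ n)
      have h2 : 0 ≤ (1 - ε) * p (φ n) := mul_nonneg (by linarith) (hppos _).le
      linarith
    · have : Tendsto (fun n => ((1 + ε) - σ * (1 - ε)) * ∑ i ∈ Finset.range (φ n), p i +
          (c2 + 2 * s * c1)) atTop atBot :=
        tendsto_atBot_add_const_right _ _ (hS.const_mul_atTop_of_neg hεσ)
      refine tendsto_atBot_mono' _ ?_ this
      filter_upwards [hlast] with n hn
      rw [hn]
      have h1 := mul_le_mul_of_nonneg_left (hc1 (φ n)) hs0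
      have h2 := hc2 (φ n)
      have h3 := mul_le_mul_of_nonneg_left (hφr n) (mul_nonneg hs0 (by linarith : 0 ≤ 1 - ε))
      simp only [hσ, hp] at *
      nlinarith
  have hcov : {x | x ∈ Lam ∧
        Tendsto (fun n : ℕ => Real.log (cfA n x) / ψ n) atTop (nhds 1)} ⊆
      ⋃ q : ℕ × ℕ, FF (lam q.1) (ups q.1 q.2) := by
    rintro x ⟨hx, hlim⟩
    have hT := Lam_T hx
    have hlim' : Tendsto (fun n : ℕ => Real.log (dg n x) / p n) atTop (nhds 1) :=
      (tendsto_add_atTop_iff_nat 1).2 hlim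
    have e1 := hlim'.eventually_const_lt (show 1 - ε < 1 by linarith)
    have e2 := hlim'.eventually_lt_const (show 1 < 1 + ε / 2 by linarith)
    have e3 := log_small ψ hψ (ε / 2) (by linarith)
    obtain ⟨N, hN⟩ := eventually_atTop.1 (e1.and (e2.and e3))
    obtain ⟨K, hK⟩ := exists_nat_ge (∑ i ∈ Finset.range N, Real.log (dg i x + 1))
    have hge1 : ∀ i, (1:ℝ) ≤ dg i x := fun i => by exact_mod_cast dg_pos (hT i)
    refine mem_iUnion.2 ⟨(N, K), hT, fun i => ?_⟩
    by_cases hi : i < N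
    · simp only [lam, ups, hi, if_true]
      refine ⟨Real.log_nonneg (hge1 i), le_trans ?_ hK⟩
      exact Finset.single_le_sum (f := fun i => Real.log ((dg i x : ℝ) + 1))
        (fun j _ => Real.log_nonneg (by linarith [hge1 j])) (Finset.mem_range.2 hi)
    · simp only [lam, ups, hi, if_false]
      obtain ⟨h1, h2, h3⟩ := hN i (not_lt.1 hi)
      rw [lt_div_iff₀ (hppos i)] at h1
      rw [div_lt_iff₀ (hppos i)] at h2
      refine ⟨h1.le, ?_⟩
      have h4 : Real.log (dg i x + 1) ≤ Real.log 2 + Real.log (dg i x) := by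
        rw [← Real.log_mul (by norm_num) (by linarith [hge1 i])]
        exact Real.log_le_log (by linarith [hge1 i]) (by linarith [hge1 i])
      have h5 : Real.log 2 ≤ Real.log (2 * ((i:ℝ) + 2)) :=
        Real.log_le_log (by norm_num) (by linarith [(Nat.cast_nonneg i : (0:ℝ) ≤ i)])
      simp only [hp] at *
      linarith
  refine (dimH_mono hcov).trans ?_
  rw [dimH_iUnion]
  exact iSup_le fun q => hzero _ _

/-- nested cylinders -/
def JJ : ℕ → (ℕ → ℕ) → Set ℝ
  | 0, _ => Icc 0 1
  | n + 1, a => (fun t : ℝ => 1 / ((a 0 : ℝ) + t)) '' JJ n (fun i => a (i + 1))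

lemma JJ_sub_Icc (n : ℕ) : ∀ a : ℕ → ℕ, (∀ i, 1 ≤ a i) → JJ n a ⊆ Icc 0 1 := by
  induction n with
  | zero => intro a _; exact subset_rfl
  | succ n ih =>
    rintro a ha _ ⟨t, ht, rfl⟩
    have ht' := ih _ (fun i => ha (i + 1)) ht
    have h1 : (1:ℝ) ≤ a 0 := by exact_mod_cast ha 0
    have h2 := ht'.1
    refine ⟨by positivity, ?_⟩
    show 1 / ((a 0 : ℝ) + t) ≤ 1
    rw [div_le_one (by linarith)]
    linarith

lemma JJ_anti (n : ℕ) : ∀ a : ℕ → ℕ, (∀ i, 1 ≤ a i) → JJ (n + 1) a ⊆ JJ n a := by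
  induction n with
  | zero => intro a ha; exact JJ_sub_Icc 1 a ha
  | succ n ih =>
    intro a ha
    exact image_mono (ih _ (fun i => ha (i + 1)))

lemma JJ_compact (n : ℕ) : ∀ a : ℕ → ℕ, (∀ i, 1 ≤ a i) → IsCompact (JJ n a) := by
  induction n with
  | zero => intro a _; exact isCompact_Icc
  | succ n ih =>
    intro a ha
    refine (ih _ (fun i => ha (i + 1))).image_of_continuousOn ?_
    refine ContinuousOn.div continuousOn_const (by fun_prop) ?_
    intro t ht
    have h1 : (1:ℝ) ≤ a 0 := by exact_mod_cast ha 0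
    have h2 := (JJ_sub_Icc n _ (fun i => ha (i + 1)) ht).1
    exact ne_of_gt (by linarith)

lemma JJ_nonempty (n : ℕ) : ∀ a : ℕ → ℕ, (JJ n a).Nonempty := by
  induction n with
  | zero => intro a; exact ⟨0, by simp [JJ]⟩
  | succ n ih => intro a; exact (ih _).image _

/-- limit set of the cylinders -/
def XX (a : ℕ → ℕ) : Set ℝ := ⋂ n, JJ n a

lemma XX_nonempty (a : ℕ → ℕ) (ha : ∀ i, 1 ≤ a i) : (XX a).Nonempty :=
  IsCompact.nonempty_iInter_of_sequence_nonempty_isCompact_isClosed _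
    (fun n => JJ_anti n a ha) (fun n => JJ_nonempty n a) (JJ_compact 0 a ha)
    (fun n => (JJ_compact n a ha).isClosed)

lemma XX_step {a : ℕ → ℕ} {x : ℝ} (hx : x ∈ XX a) :
    x⁻¹ - a 0 ∈ XX (fun i => a (i + 1)) := by
  refine mem_iInter.2 fun n => ?_
  obtain ⟨t, ht, hxt⟩ := mem_iInter.1 hx (n + 1)
  have : x⁻¹ - a 0 = t := by rw [← hxt]; simp
  rwa [this]

lemma XX_pos {a : ℕ → ℕ} (ha : ∀ i, 1 ≤ a i) {x : ℝ} (hx : x ∈ XX a) : 0 < x := by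
  obtain ⟨t, ht, hxt⟩ := mem_iInter.1 hx 1
  have h1 : (1:ℝ) ≤ a 0 := by exact_mod_cast ha 0
  have h2 : 0 ≤ t := ht.1
  rw [← hxt]
  show 0 < 1 / ((a 0 : ℝ) + t)
  positivity

lemma XX_lt {a : ℕ → ℕ} (ha : ∀ i, 1 ≤ a i) {x : ℝ} (hx : x ∈ XX a) : x < 1 := by
  have h0 := XX_pos ha hx
  have h1 := XX_pos (fun i => ha (i + 1)) (XX_step hx)
  have h2 : (1:ℝ) ≤ a 0 := by exact_mod_cast ha 0
  rw [← one_lt_inv₀ h0]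
  linarith

lemma XX_gauss {a : ℕ → ℕ} (ha : ∀ i, 1 ≤ a i) {x : ℝ} (hx : x ∈ XX a) :
    gaussMap x = x⁻¹ - a 0 ∧ ⌊x⁻¹⌋₊ = a 0 := by
  have h0 := XX_pos (fun i => ha (i + 1)) (XX_step hx)
  have h1 := XX_lt (fun i => ha (i + 1)) (XX_step hx)
  have h2 : ⌊x⁻¹⌋₊ = a 0 := by
    rw [Nat.floor_eq_iff (by linarith [(Nat.cast_nonneg (a 0) : (0:ℝ) ≤ a 0)])]
    constructor <;> linarith
  refine ⟨?_, h2⟩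
  rw [gaussMap, Int.fract, ← natCast_floor_eq_intCast_floor (inv_nonneg.2 (XX_pos ha hx).le), h2]

lemma XX_T {a : ℕ → ℕ} (ha : ∀ i, 1 ≤ a i) {x : ℝ} (hx : x ∈ XX a) (n : ℕ) :
    T n x ∈ XX (fun i => a (i + n)) := by
  induction n with
  | zero => exact hx
  | succ n ih =>
    have h1 := XX_step ih
    rw [T_succ, (XX_gauss (fun i => ha (i + n)) ih).1]
    simp only [add_assoc, add_comm 1 n] at h1
    exact h1

lemma exists_cf (a : ℕ → ℕ) (ha : ∀ i, 1 ≤ a i) :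
    ∃ x : ℝ, (∀ n, T n x ∈ Ioo (0:ℝ) 1) ∧ ∀ n, dg n x = a n := by
  obtain ⟨x, hx⟩ := XX_nonempty a ha
  refine ⟨x, fun n => ⟨XX_pos (fun i => ha (i + n)) (XX_T ha hx n),
    XX_lt (fun i => ha (i + n)) (XX_T ha hx n)⟩, fun n => ?_⟩
  have := (XX_gauss (fun i => ha (i + n)) (XX_T ha hx n)).2
  simpa [dg] using this

/-- mixed radix remainders -/
noncomputable def RR (m : ℕ → ℕ) (y : ℝ) : ℕ → ℝ
  | 0 => y
  | n + 1 => Int.fract (m n * RR m y n)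

/-- mixed radix digits -/
noncomputable def DD (m : ℕ → ℕ) (y : ℝ) (n : ℕ) : ℕ := ⌊m n * RR m y n⌋₊

lemma RR_mem (m : ℕ → ℕ) {y : ℝ} (hy : y ∈ Ico (0:ℝ) 1) (n : ℕ) : RR m y n ∈ Ico (0:ℝ) 1 := by
  cases n with
  | zero => exact hy
  | succ n => exact ⟨Int.fract_nonneg _, Int.fract_lt_one _⟩

lemma RR_eq (m : ℕ → ℕ) {y : ℝ} (hy : y ∈ Ico (0:ℝ) 1) (n : ℕ) :
    m n * RR m y n = DD m y n + RR m y (n + 1) := by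
  have h0 : 0 ≤ m n * RR m y n := mul_nonneg (Nat.cast_nonneg _) (RR_mem m hy n).1
  rw [DD, RR, natCast_floor_eq_intCast_floor h0]
  exact (Int.floor_add_fract _).symm

lemma DD_lt (m : ℕ → ℕ) (hm : ∀ i, 0 < m i) {y : ℝ} (hy : y ∈ Ico (0:ℝ) 1) (n : ℕ) :
    DD m y n < m n := by
  have h := RR_mem m hy n
  have h1 : (0:ℝ) < m n := by exact_mod_cast hm n
  rw [DD, Nat.floor_lt (mul_nonneg h1.le h.1)]
  nlinarith [h.2]

lemma RR_dist (m : ℕ → ℕ) {y y' : ℝ} (hy : y ∈ Ico (0:ℝ) 1) (hy' : y' ∈ Ico (0:ℝ) 1)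
    (n : ℕ) (h : ∀ i < n, DD m y i = DD m y' i) :
    |y - y'| * ∏ i ∈ Finset.range n, (m i : ℝ) = |RR m y n - RR m y' n| := by
  induction n with
  | zero => simp [RR]
  | succ n ih =>
    have ih' := ih (fun i hi => h i (by omega))
    rw [Finset.prod_range_succ, ← mul_assoc, ih']
    have h1 := RR_eq m hy n
    have h2 := RR_eq m hy' n
    rw [← h n (by omega)] at h2
    rw [← abs_of_nonneg (Nat.cast_nonneg (m n) : (0:ℝ) ≤ m n), ← abs_mul]
    congr 1
    linarith

lemma DD_ne (m : ℕ → ℕ) (hm : ∀ i, 2 ≤ m i) {y y' : ℝ} (hy : y ∈ Ico (0:ℝ) 1)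
    (hy' : y' ∈ Ico (0:ℝ) 1) (hne : y ≠ y') :
    ∃ n, (∀ i < n, DD m y i = DD m y' i) ∧ DD m y n ≠ DD m y' n := by
  have hex : ∃ n, DD m y n ≠ DD m y' n := by
    by_contra! hcon
    have h1 : ∀ n : ℕ, |y - y'| * 2 ^ n ≤ 1 := by
      intro n
      have h2 := RR_dist m hy hy' n (fun i _ => hcon i)
      have h3 : (2:ℝ) ^ n ≤ ∏ i ∈ Finset.range n, (m i : ℝ) := by
        have : (2:ℝ) ^ n = ∏ i ∈ Finset.range n, (2:ℝ) := by simp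
        rw [this]
        exact Finset.prod_le_prod (fun _ _ => by norm_num) (fun i _ => by exact_mod_cast hm i)
      have h4 : |RR m y n - RR m y' n| ≤ 1 := by
        have ha := RR_mem m hy n
        have hb := RR_mem m hy' n
        rw [abs_le]
        constructor <;> linarith [ha.1, ha.2, hb.1, hb.2]
      rw [← h2] at h4
      exact le_trans (by gcongr) h4
    have hpos : 0 < |y - y'| := abs_pos.2 (sub_ne_zero.2 hne)
    obtain ⟨n, hn⟩ := pow_unbounded_of_one_lt (1 / |y - y'|) (by norm_num : (1:ℝ) < 2)
    rw [div_lt_iff₀ hpos] at hn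
    linarith [h1 n]
  classical
  exact ⟨Nat.find hex, fun i hi => not_not.1 (Nat.find_min hex hi), Nat.find_spec hex⟩

lemma const_bound (p : ℕ → ℝ) (m : ℕ → ℕ) (hp : ∀ i, 0 < p i)
    (hm : ∀ i, Real.exp (p i) ≤ m i) (hm2 : ∀ i, (m i : ℝ) ≤ 2 * Real.exp (p i))
    (hlog : ∀ ε : ℝ, 0 < ε → ∀ᶠ i : ℕ in atTop, Real.log (2 * (i + 2)) ≤ ε * p i)
    (s r : ℝ) (hs : 0 < s) (hr : 0 ≤ r) (hsr : s * (2 + r) < 1)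
    (hev : ∀ᶠ n : ℕ in atTop, p n ≤ r * ∑ i ∈ Finset.range n, p i) :
    ∃ K : ℝ, 0 < K ∧ ∀ n, 1 / ∏ i ∈ Finset.range n, (m i : ℝ) ≤
      K * ((m n : ℝ) / (2 * (∏ i ∈ Finset.range (n + 1), ((i + 2 : ℝ) * m i)) ^ 2)) ^ s := by
  have hmpos : ∀ i, (0:ℝ) < m i := fun i => (Real.exp_pos _).trans_le (hm i)
  have hlm : ∀ i, p i ≤ Real.log (m i) := fun i =>
    (Real.le_log_iff_exp_le (hmpos i)).2 (hm i)
  have hBpos : ∀ i : ℕ, (0:ℝ) < (i + 2 : ℝ) * m i := fun i => mul_pos (by positivity) (hmpos i)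
  set ε : ℝ := (1 - s * (2 + r)) / 2 with hε
  have hε0 : 0 < ε := by rw [hε]; linarith
  obtain ⟨N, hN⟩ := eventually_atTop.1 (hlog ε hε0)
  obtain ⟨c0, hc0⟩ := sum_le_aux (fun i : ℕ => Real.log ((i + 2 : ℝ) * m i))
    (fun i => (1 + ε) * p i) N (by
      intro i hi
      have h1 : Real.log ((i + 2 : ℝ) * m i) ≤ Real.log ((2 * (i + 2)) * Real.exp (p i)) := by
        apply Real.log_le_log (hBpos i)
        have := mul_le_mul_of_nonneg_left (hm2 i) (by positivity : (0:ℝ) ≤ (i + 2 : ℝ))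
        linarith
      rw [Real.log_mul (by positivity) (Real.exp_pos _).ne', Real.log_exp] at h1
      have := hN i hi
      linarith)
  let h : ℕ → ℝ := fun n => 2 * s * ∑ i ∈ Finset.range (n + 1), Real.log ((i + 2 : ℝ) * m i) +
    s * Real.log 2 - s * Real.log (m n) - ∑ i ∈ Finset.range n, Real.log (m i)
  have hb : IsBoundedUnder (· ≤ ·) atTop h := by
    refine ⟨2 * s * c0 + s * Real.log 2, ?_⟩
    rw [eventually_map]
    filter_upwards [hev] with n hn
    have h1 := hc0 (n + 1)
    rw [← Finset.mul_sum, Finset.sum_range_succ (fun i => p i)] at h1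
    have h2 : ∑ i ∈ Finset.range n, p i ≤ ∑ i ∈ Finset.range n, Real.log (m i) :=
      Finset.sum_le_sum fun i _ => hlm i
    have h3 := mul_le_mul_of_nonneg_left (hlm n) hs.le
    have h1' := mul_le_mul_of_nonneg_left h1 (by linarith : 0 ≤ 2 * s)
    set S := ∑ i ∈ Finset.range n, p i with hS
    have hS0 : 0 ≤ S := Finset.sum_nonneg fun i _ => (hp i).le
    have h4 := mul_le_mul_of_nonneg_left hn (by positivity : 0 ≤ s * (1 + 2 * ε))
    have h5 : (2 * s * (1 + ε) + s * (1 + 2 * ε) * r - 1) * S ≤ 0 := by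
      apply mul_nonpos_of_nonpos_of_nonneg _ hS0
      have h6 : s * (1 + r) ≤ 1 := by nlinarith
      nlinarith
    simp only [h]
    nlinarith
  obtain ⟨c, hc⟩ := hb.bddAbove_range
  refine ⟨Real.exp c, Real.exp_pos _, fun n => ?_⟩
  have hcn : h n ≤ c := hc ⟨n, rfl⟩
  have e1 : ∏ i ∈ Finset.range n, (m i : ℝ) =
      Real.exp (∑ i ∈ Finset.range n, Real.log (m i)) := by
    rw [Real.exp_sum]
    exact Finset.prod_congr rfl fun i _ => (Real.exp_log (hmpos i)).symm
  have e2 : ∏ i ∈ Finset.range (n + 1), ((i + 2 : ℝ) * m i) =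
      Real.exp (∑ i ∈ Finset.range (n + 1), Real.log ((i + 2 : ℝ) * m i)) := by
    rw [Real.exp_sum]
    exact Finset.prod_congr rfl fun i _ => (Real.exp_log (hBpos i)).symm
  have e3 : (m n : ℝ) / (2 * (∏ i ∈ Finset.range (n + 1), ((i + 2 : ℝ) * m i)) ^ 2) =
      Real.exp (Real.log (m n) - (Real.log 2 +
        2 * ∑ i ∈ Finset.range (n + 1), Real.log ((i + 2 : ℝ) * m i))) := by
    rw [e2, Real.exp_sub, Real.exp_add, Real.exp_log (hmpos n), Real.exp_log (by norm_num),
      ← Real.exp_nat_mul]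
    norm_num
  rw [e1, e3, ← Real.exp_mul, ← Real.exp_add, one_div, ← Real.exp_neg, Real.exp_le_exp]
  simp only [h] at hcn
  linarith

lemma sep (m : ℕ → ℕ) (hm : ∀ i, 2 ≤ m i) (s K : ℝ) (hs : 0 < s) (hs1 : s ≤ 1) (hK0 : 0 < K)
    (hK : ∀ n, 1 / ∏ i ∈ Finset.range n, (m i : ℝ) ≤
      K * ((m n : ℝ) / (2 * (∏ i ∈ Finset.range (n + 1), ((i + 2 : ℝ) * m i)) ^ 2)) ^ s)
    {y y' x x' : ℝ} (hy : y ∈ Ico (0:ℝ) 1) (hy' : y' ∈ Ico (0:ℝ) 1)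
    (hx : ∀ n, T n x ∈ Ioo (0:ℝ) 1) (hx' : ∀ n, T n x' ∈ Ioo (0:ℝ) 1)
    (hd : ∀ n, dg n x = (n + 1) * m n + DD m y n)
    (hd' : ∀ n, dg n x' = (n + 1) * m n + DD m y' n) :
    |y - y'| ≤ 2 * K * |x - x'| ^ s := by
  rcases eq_or_ne y y' with rfl | hne
  · simp; positivity
  have hm0 : ∀ i, 0 < m i := fun i => by have := hm i; omega
  obtain ⟨n, hn, hnn⟩ := DD_ne m hm hy hy' hne
  have hmn : (0:ℝ) < m n := by exact_mod_cast hm0 n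
  set k : ℝ := |(DD m y n : ℝ) - DD m y' n| with hk
  have hk1 : 1 ≤ k := by
    have h1 : ((DD m y n : ℤ) - DD m y' n) ≠ 0 := by
      intro h; apply hnn; omega
    have h2 := Int.one_le_abs h1
    rw [hk]
    exact_mod_cast h2
  have hkm : k ≤ m n := by
    have h1 : (DD m y n : ℝ) < m n := by exact_mod_cast DD_lt m hm0 hy n
    have h2 : (DD m y' n : ℝ) < m n := by exact_mod_cast DD_lt m hm0 hy' n
    have h3 : (0:ℝ) ≤ DD m y n := Nat.cast_nonneg _
    have h4 : (0:ℝ) ≤ DD m y' n := Nat.cast_nonneg _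
    rw [hk, abs_le]
    constructor <;> linarith
  set M : ℝ := ∏ i ∈ Finset.range n, (m i : ℝ) with hM
  have hM0 : 0 < M := Finset.prod_pos fun i _ => by exact_mod_cast hm0 i
  -- distance on the radix side
  have hyd : |y - y'| ≤ 2 * (k / m n) * (1 / M) := by
    have h1 := RR_dist m hy hy' n hn
    have h2 : (m n : ℝ) * |RR m y n - RR m y' n| ≤ 2 * k := by
      rw [← abs_of_pos hmn, ← abs_mul, mul_sub, RR_eq m hy, RR_eq m hy']
      have ha := RR_mem m hy (n + 1)
      have hb := RR_mem m hy' (n + 1)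
      have h3 : |RR m y (n + 1) - RR m y' (n + 1)| ≤ 1 := by
        rw [abs_le]
        constructor <;> linarith [ha.1, ha.2, hb.1, hb.2]
      calc |(DD m y n : ℝ) + RR m y (n + 1) - (DD m y' n + RR m y' (n + 1))|
          = |((DD m y n : ℝ) - DD m y' n) + (RR m y (n + 1) - RR m y' (n + 1))| := by
            congr 1; ring
        _ ≤ k + |RR m y (n + 1) - RR m y' (n + 1)| := abs_add_le _ _
        _ ≤ 2 * k := by linarith
    rw [← h1] at h2
    have h4 : 2 * (k / m n) * (1 / M) = 2 * k / (m n * M) := by field_simp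
    rw [h4, le_div_iff₀ (by positivity)]
    linarith
  -- distance on the continued fraction side
  have hdg2 : ∀ {z w : ℝ}, (∀ n, T n z ∈ Ioo (0:ℝ) 1) →
      (∀ n, dg n z = (n + 1) * m n + DD m w n) → ∀ n, T n z ≤ 1 / 2 := by
    intro z w hz hzd i
    refine (T_le hz).trans ?_
    apply one_div_le_one_div_of_le (by norm_num)
    have : 2 ≤ dg i z := by
      rw [hzd i]
      have := hm i
      nlinarith
    exact_mod_cast this
  have hB : ∀ {z w : ℝ}, w ∈ Ico (0:ℝ) 1 →
      (∀ n, dg n z = (n + 1) * m n + DD m w n) → ∀ n, (dg n z : ℝ) + 1 ≤ (n + 2 : ℝ) * m n := by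
    intro z w hw hzd i
    have h1 := DD_lt m hm0 hw i
    have h2 : dg i z + 1 ≤ (i + 2) * m i := by rw [hzd i]; nlinarith
    exact_mod_cast h2
  have hxd : k / m n * ((m n : ℝ) / (2 * (∏ i ∈ Finset.range (n + 1), ((i + 2 : ℝ) * m i)) ^ 2))
      ≤ |x - x'| := by
    have h1 := dist_lower hx hx' n (fun i hi => by rw [hd, hd', hn i hi])
    rw [dist_step hx hx'] at h1
    have hnum : k / 2 ≤ |((dg n x' : ℝ) + T (n + 1) x') - (dg n x + T (n + 1) x)| := by
      have e : ((dg n x' : ℝ) + T (n + 1) x') - (dg n x + T (n + 1) x) =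
          -(((DD m y n : ℝ) - DD m y' n) - (T (n + 1) x' - T (n + 1) x)) := by
        rw [hd, hd']; push_cast; ring
      rw [e, abs_neg]
      have h2 := abs_sub_abs_le_abs_sub ((DD m y n : ℝ) - DD m y' n) (T (n + 1) x' - T (n + 1) x)
      have h3 : |T (n + 1) x' - T (n + 1) x| ≤ 1 / 2 := by
        have ha := hdg2 hx hd (n + 1)
        have hb := hdg2 hx' hd' (n + 1)
        have hc := (hx (n + 1)).1
        have hc' := (hx' (n + 1)).1
        rw [abs_le]
        constructor <;> linarith
      linarith
    have hden : ((dg n x : ℝ) + T (n + 1) x) * (dg n x' + T (n + 1) x') ≤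
        ((n + 2 : ℝ) * m n) ^ 2 := by
      rw [sq]
      have ha := hB hy hd n
      have hb := hB hy' hd' n
      have hc := hx (n + 1)
      have hc' := hx' (n + 1)
      apply mul_le_mul
      · linarith [hc.2]
      · linarith [hc'.2]
      · have := hc'.1; positivity
      · positivity
    have hdpos : 0 < ((dg n x : ℝ) + T (n + 1) x) * (dg n x' + T (n + 1) x') := by
      have := (hx (n + 1)).1
      have := (hx' (n + 1)).1
      positivity
    have hP : ∏ i ∈ Finset.range n, ((dg i x : ℝ) + 1) ≤
        ∏ i ∈ Finset.range n, ((i + 2 : ℝ) * m i) :=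
      Finset.prod_le_prod (fun _ _ => by positivity) fun i _ => hB hy hd i
    have hP0 : 0 ≤ ∏ i ∈ Finset.range n, ((dg i x : ℝ) + 1) :=
      Finset.prod_nonneg fun _ _ => by positivity
    have hQ0 : 0 < ∏ i ∈ Finset.range n, ((i + 2 : ℝ) * m i) :=
      Finset.prod_pos fun i _ => mul_pos (by positivity) (by exact_mod_cast hm0 i)
    have h5 : k / 2 / ((n + 2 : ℝ) * m n) ^ 2 ≤
        |x - x'| * (∏ i ∈ Finset.range n, ((i + 2 : ℝ) * m i)) ^ 2 := by
      refine le_trans ?_ (h1.trans ?_)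
      · exact div_le_div₀ (abs_nonneg _) hnum hdpos hden
      · gcongr
    rw [Finset.prod_range_succ]
    rw [div_le_iff₀ (by positivity)] at h5
    have h6 : k / m n * ((m n : ℝ) / (2 * ((∏ i ∈ Finset.range n, ((i + 2 : ℝ) * m i)) *
        ((n + 2 : ℝ) * m n)) ^ 2)) = k / 2 / ((∏ i ∈ Finset.range n, ((i + 2 : ℝ) * m i)) *
        ((n + 2 : ℝ) * m n)) ^ 2 := by
      field_simp
    rw [h6, div_le_iff₀ (by positivity)]
    rw [mul_pow]
    linarith
  have hkm0 : 0 < k / m n := by positivity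
  have hkm1 : k / m n ≤ 1 := (div_le_one hmn).2 hkm
  calc |y - y'| ≤ 2 * (k / m n) * (1 / M) := hyd
    _ ≤ 2 * (k / m n) ^ s * (K * ((m n : ℝ) /
          (2 * (∏ i ∈ Finset.range (n + 1), ((i + 2 : ℝ) * m i)) ^ 2)) ^ s) := by
        have h7 : k / m n ≤ (k / m n) ^ s := by
          have := Real.rpow_le_rpow_of_exponent_ge hkm0 hkm1 hs1
          rwa [Real.rpow_one] at this
        have h8 := hK n
        gcongr
    _ = 2 * K * (k / m n * ((m n : ℝ) /
          (2 * (∏ i ∈ Finset.range (n + 1), ((i + 2 : ℝ) * m i)) ^ 2))) ^ s := by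
        rw [Real.mul_rpow hkm0.le (by positivity)]
        ring
    _ ≤ 2 * K * |x - x'| ^ s := by
        gcongr

lemma lower_bound (ψ : ℕ → ℝ) (hψpos : ∀ n, 0 < ψ n) (hmono : Monotone ψ)
    (hψ : Tendsto (fun n : ℕ => ψ n / Real.log n) atTop atTop)
    (s : NNReal) (hs : 0 < s) (r : ℝ) (hr : 0 ≤ r) (hsr : s * (2 + r) < 1)
    (hev : ∀ᶠ n : ℕ in atTop, ψ (n + 1) ≤ r * ∑ i ∈ Finset.range n, ψ (i + 1)) :
    s ≤ dimH {x | x ∈ Lam ∧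
        Tendsto (fun n : ℕ => Real.log (cfA n x) / ψ n) atTop (nhds 1)} := by
  set E := {x | x ∈ Lam ∧
        Tendsto (fun n : ℕ => Real.log (cfA n x) / ψ n) atTop (nhds 1)} with hE
  let m : ℕ → ℕ := fun i => ⌈Real.exp (ψ (i + 1))⌉₊
  have hm : ∀ i, Real.exp (ψ (i + 1)) ≤ m i := fun i => Nat.le_ceil _
  have hexp1 : ∀ i, 1 < Real.exp (ψ (i + 1)) := fun i => Real.one_lt_exp_iff.2 (hψpos _)
  have hm2 : ∀ i, (m i : ℝ) ≤ 2 * Real.exp (ψ (i + 1)) := fun i => by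
    have := (Nat.ceil_lt_add_one (Real.exp_pos (ψ (i + 1))).le).le
    have := hexp1 i
    simp only [m]; linarith
  have hmge : ∀ i, 2 ≤ m i := fun i => by
    have : 1 < m i := Nat.lt_ceil.2 (by simpa using hexp1 i)
    omega
  have hmm : ∀ i, m i ≤ m (i + 1) := fun i =>
    Nat.ceil_mono (Real.exp_le_exp.2 (hmono (by omega)))
  have hs0 : (0:ℝ) < s := hs
  obtain ⟨K, hK0, hK⟩ := const_bound (fun i => ψ (i + 1)) m (fun i => hψpos _) hm hm2
    (fun ε hε => log_small ψ hψ ε hε) s r hs0 hr hsr hev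
  have hs1 : (s:ℝ) ≤ 1 := by nlinarith
  choose g hg hgd using fun y : ℝ => exists_cf (fun i => (i + 1) * m i + DD m y i)
    (fun i => by have := hmge i; nlinarith)
  have hsep : ∀ y ∈ Ico (0:ℝ) 1, ∀ y' ∈ Ico (0:ℝ) 1, |y - y'| ≤ 2 * K * |g y - g y'| ^ (s:ℝ) :=
    fun y hy y' hy' => sep m hmge s K hs0 hs1 hK0 hK hy hy' (hg y) (hg y') (hgd y) (hgd y')
  have hinj : InjOn g (Ico (0:ℝ) 1) := by
    intro y hy y' hy' h
    have h1 := hsep y hy y' hy'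
    rw [h, sub_self, abs_zero, Real.zero_rpow hs0.ne', mul_zero] at h1
    exact sub_eq_zero.1 (abs_nonpos_iff.1 h1)
  have hsub : g '' Ico (0:ℝ) 1 ⊆ E := by
    rintro _ ⟨y, hy, rfl⟩
    refine ⟨⟨hg y 0, fun n hn => ?_⟩, ?_⟩
    · obtain ⟨n, rfl⟩ : ∃ k, n = k + 1 := ⟨n - 1, by omega⟩
      rw [cfA_succ, cfA_succ, hgd, hgd]
      have h1 := DD_lt m (fun i => by have := hmge i; omega) hy n
      have h2 := hmm n
      nlinarith
    · rw [← tendsto_add_atTop_iff_nat 1]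
      have hl0 : Tendsto (fun n : ℕ => 1 + Real.log (2 * (n + 2)) / ψ (n + 1)) atTop
          (nhds 1) := by
        have : Tendsto (fun n : ℕ => Real.log (2 * (n + 2)) / ψ (n + 1)) atTop (nhds 0) := by
          rw [Metric.tendsto_nhds]
          intro ε hε
          filter_upwards [log_small ψ hψ (ε / 2) (by linarith)] with n hn
          have h0 : 0 ≤ Real.log (2 * ((n:ℝ) + 2)) :=
            Real.log_nonneg (by linarith [(Nat.cast_nonneg n : (0:ℝ) ≤ n)])
          rw [Real.dist_eq, sub_zero, abs_of_nonneg (div_nonneg h0 (hψpos _).le),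
            div_lt_iff₀ (hψpos _)]
          nlinarith [hψpos (n + 1)]
        simpa using this.const_add 1
      refine tendsto_of_tendsto_of_tendsto_of_le_of_le tendsto_const_nhds hl0 ?_ ?_
      · intro n
        show 1 ≤ Real.log (cfA (n + 1) (g y)) / ψ (n + 1)
        rw [cfA_succ, hgd, le_div_iff₀ (hψpos _), one_mul, Real.le_log_iff_exp_le]
        · refine (hm n).trans ?_
          exact_mod_cast (by nlinarith : m n ≤ (n + 1) * m n + DD m y n)
        · have := hmge n
          exact_mod_cast (by nlinarith : 0 < (n + 1) * m n + DD m y n)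
      · intro n
        show Real.log (cfA (n + 1) (g y)) / ψ (n + 1) ≤ 1 + Real.log (2 * (n + 2)) / ψ (n + 1)
        have h1 := DD_lt m (fun i => by have := hmge i; omega) hy n
        have h2 : (((n + 1) * m n + DD m y n : ℕ) : ℝ) ≤ (n + 2) * m n := by
          exact_mod_cast (by nlinarith : (n + 1) * m n + DD m y n ≤ (n + 2) * m n)
        have h3 : (0:ℝ) < (((n + 1) * m n + DD m y n : ℕ) : ℝ) := by
          have := hmge n
          exact_mod_cast (by nlinarith : 0 < (n + 1) * m n + DD m y n)
        have h4 : (((n + 1) * m n + DD m y n : ℕ) : ℝ) ≤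
            (2 * (n + 2)) * Real.exp (ψ (n + 1)) := by
          have := mul_le_mul_of_nonneg_left (hm2 n) (by positivity : (0:ℝ) ≤ (n + 2 : ℝ))
          linarith
        have h5 := Real.log_le_log h3 h4
        rw [Real.log_mul (by positivity) (Real.exp_pos _).ne', Real.log_exp] at h5
        have h6 := hψpos (n + 1)
        rw [cfA_succ, hgd, div_le_iff₀ h6, add_mul (1:ℝ), div_mul_cancel₀ _ h6.ne']
        linarith
  let f := Function.invFunOn g (Ico (0:ℝ) 1)
  have hf : ∀ y ∈ Ico (0:ℝ) 1, f (g y) = y := fun y hy => hinj.leftInvOn_invFunOn hy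
  have hholder : HolderOnWith (2 * K).toNNReal s f (g '' Ico (0:ℝ) 1) := by
    rintro _ ⟨y, hy, rfl⟩ _ ⟨y', hy', rfl⟩
    rw [hf y hy, hf y' hy', edist_dist, edist_dist, Real.dist_eq, Real.dist_eq,
      ENNReal.ofReal_rpow_of_nonneg (abs_nonneg _) hs0.le]
    show _ ≤ ENNReal.ofReal (2 * K) * _
    rw [← ENNReal.ofReal_mul (by positivity)]
    exact ENNReal.ofReal_le_ofReal (hsep y hy y' hy')
  have himg : f '' (g '' Ico (0:ℝ) 1) = Ico (0:ℝ) 1 := by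
    rw [image_image]
    conv_rhs => rw [← image_id (Ico (0:ℝ) 1)]
    exact image_congr hf
  have h1 := hholder.dimH_image_le hs
  rw [himg, Real.dimH_of_nonempty_interior (by rw [interior_Ico]; exact ⟨1/2, by norm_num⟩)] at h1
  simp only [Module.finrank_self, Nat.cast_one] at h1
  rw [ENNReal.le_div_iff_mul_le (Or.inl (by exact_mod_cast hs.ne')) (Or.inl ENNReal.coe_ne_top),
    one_mul] at h1
  exact h1.trans (dimH_mono hsub)

end CFDim
/-- If `ψ` is non-decreasing with `ψ(n)/log n → ∞`, and
`C = 1 + limsup ψ(n+1)/(ψ(1)+⋯+ψ(n)) ∈ [1,∞]`, then `E(Λ,ψ)` has Hausdorff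
dimension `1/(C+1)`. -/
theorem dimH_E_Lam (ψ : ℕ → ℝ) (hψpos : ∀ n, 0 < ψ n) (hmono : Monotone ψ)
    (hψ : Tendsto (fun n : ℕ => ψ n / Real.log n) atTop atTop)
    (C : ℝ≥0∞)
    (hC : C = 1 + Filter.limsup
      (fun n : ℕ => ENNReal.ofReal (ψ (n + 1) / ∑ k ∈ Finset.Icc 1 n, ψ k)) atTop) :
    dimH {x | x ∈ Lam ∧
        Tendsto (fun n : ℕ => Real.log (cfA n x) / ψ n) atTop (nhds 1)} =
      (C + 1)⁻¹ := by
  have hS : ∀ n : ℕ, 1 ≤ n → 0 < ∑ i ∈ Finset.range n, ψ (i + 1) := fun n hn =>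
    Finset.sum_pos (fun i _ => hψpos _) ⟨0, Finset.mem_range.2 hn⟩
  simp only [CFDim.sum_Icc_eq] at hC
  set L := Filter.limsup
      (fun n : ℕ => ENNReal.ofReal (ψ (n + 1) / ∑ k ∈ Finset.range n, ψ (k + 1))) atTop with hL
  have hC2 : C + 1 = 2 + L := by rw [hC, add_right_comm, one_add_one_eq_two]
  rw [hC2]
  apply le_antisymm
  · refine le_of_forall_gt_imp_ge_of_dense fun d hd => ?_
    obtain ⟨s, hs1, hs2⟩ := ENNReal.lt_iff_exists_nnreal_btwn.1 hd
    refine le_trans ?_ hs2.le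
    have hs0 : 0 < s := by
      have := lt_of_le_of_lt zero_le hs1
      exact_mod_cast this
    have hs0' : (0:ℝ) < s := hs0
    have hlt : ((s⁻¹ : NNReal) : ℝ≥0∞) < 2 + L := by
      rw [ENNReal.coe_inv hs0.ne']
      exact ENNReal.inv_lt_iff_inv_lt.1 hs1
    by_cases h2 : s⁻¹ < 2
    · refine CFDim.upper_bound ψ hψpos hmono hψ s 0 le_rfl ?_ ?_
      · have : ((s⁻¹ : NNReal) : ℝ) < 2 := by exact_mod_cast h2
        rw [NNReal.coe_inv, inv_lt_iff_one_lt_mul₀ hs0'] at this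
        linarith
      · refine Frequently.of_forall fun n => ?_
        rw [zero_mul]; exact (hψpos _).le
    · obtain ⟨q, hq⟩ : ∃ q : NNReal, s⁻¹ = 2 + q := ⟨s⁻¹ - 2, (add_tsub_cancel_of_le (not_lt.1 h2)).symm⟩
      have hqL : (q : ℝ≥0∞) < L := by
        rw [hq] at hlt
        push_cast at hlt
        exact (ENNReal.add_lt_add_iff_left (by norm_num)).1 hlt
      obtain ⟨r, hr1, hr2⟩ := ENNReal.lt_iff_exists_nnreal_btwn.1 hqL
      have hr1' : (q:ℝ) < r := by exact_mod_cast hr1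
      refine CFDim.upper_bound ψ hψpos hmono hψ s r r.coe_nonneg ?_ ?_
      · have h3 : (s:ℝ)⁻¹ = 2 + q := by exact_mod_cast hq
        have h4 : (s:ℝ) * (2 + q) = 1 := by rw [← h3, mul_inv_cancel₀ hs0'.ne']
        nlinarith
      · have hfr := frequently_lt_of_lt_limsup (by isBoundedDefault) hr2
        refine (hfr.and_eventually (eventually_ge_atTop 1)).mono ?_
        rintro n ⟨h3, h4⟩
        rw [← ENNReal.ofReal_coe_nnreal, ENNReal.ofReal_lt_ofReal_iff_of_nonneg r.coe_nonneg,
          lt_div_iff₀ (hS n h4)] at h3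
        exact h3.le
  · refine le_of_forall_lt_imp_le_of_dense fun d hd => ?_
    obtain ⟨s, hs1, hs2⟩ := ENNReal.lt_iff_exists_nnreal_btwn.1 hd
    refine hs1.le.trans ?_
    rcases eq_or_ne s 0 with rfl | hs0
    · simp
    have hspos : 0 < s := pos_iff_ne_zero.2 hs0
    have hs0' : (0:ℝ) < s := hspos
    have hlt : 2 + L < ((s⁻¹ : NNReal) : ℝ≥0∞) := by
      rw [ENNReal.coe_inv hs0]
      exact ENNReal.lt_inv_iff_lt_inv.1 hs2
    have hLtop : L ≠ ⊤ := by
      rintro h; rw [h] at hlt; simp at hlt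
    obtain ⟨q, hq⟩ : ∃ q : NNReal, s⁻¹ = 2 + q := by
      refine ⟨s⁻¹ - 2, (add_tsub_cancel_of_le ?_).symm⟩
      have : ((2 : NNReal) : ℝ≥0∞) ≤ ((s⁻¹ : NNReal) : ℝ≥0∞) :=
        le_trans (by push_cast; exact le_self_add) hlt.le
      exact_mod_cast this
    have hqL : L < (q : ℝ≥0∞) := by
      rw [hq] at hlt
      push_cast at hlt
      exact (ENNReal.add_lt_add_iff_left (by norm_num)).1 hlt
    obtain ⟨r, hr1, hr2⟩ := ENNReal.lt_iff_exists_nnreal_btwn.1 hqL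
    have hr2' : (r:ℝ) < q := by exact_mod_cast hr2
    refine CFDim.lower_bound ψ hψpos hmono hψ s hspos r r.coe_nonneg ?_ ?_
    · have h3 : (s:ℝ)⁻¹ = 2 + q := by exact_mod_cast hq
      have h4 : (s:ℝ) * (2 + q) = 1 := by rw [← h3, mul_inv_cancel₀ hs0'.ne']
      nlinarith
    · filter_upwards [eventually_lt_of_limsup_lt hr1, eventually_ge_atTop 1] with n h3 h4
      rw [← ENNReal.ofReal_coe_nnreal,
        ENNReal.ofReal_lt_ofReal_iff_of_nonneg (div_nonneg (hψpos _).le (hS n h4).le),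
        div_lt_iff₀ (hS n h4)] at h3
      exact h3.le
end
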